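/- arXiv:2101.03461 — 3 statements merged into one kernel-verified Lean document; each statement's English description precedes it below -/
import Mathlib

section
/- An epimorphism R → S in the category of supercommutative superalgebras is necessarily surjective, provided the induced map R̄ → S̄ on the purely even quotients is surjective and S is Noetherian. -/
/-!
STATEMENT 4: An epimorphism `R → S` in the category of supercommutative superalgebras is
surjective, provided the induced map `R̄ → S̄` on the largest purely even quotients is
surjective and `S` is Noetherian (its super-ideals satisfy the ACC).
-/

variable {k : Type} [Field k]

/-- The two-sided ideal generated by the odd part, as a `k`-submodule. -/
def oddIdeal {R : Type} [Ring R] [Algebra k R] (𝒜 : ZMod 2 → Submodule k R) :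
    Submodule k R :=
  Submodule.span k {x | ∃ r ∈ 𝒜 1, ∃ a b : R, x = a * r * b}

/-- A super-ideal of a superalgebra: a homogeneous two-sided ideal, viewed as a
`k`-submodule. -/
def IsSuperIdeal {R : Type} [Ring R] [Algebra k R] (𝒜 : ZMod 2 → Submodule k R)
    [GradedAlgebra 𝒜] (J : Submodule k R) : Prop :=
  (∀ r : R, ∀ x ∈ J, r * x ∈ J) ∧ (∀ r : R, ∀ x ∈ J, x * r ∈ J) ∧
  (∀ x ∈ J, ∀ i : ZMod 2, ((DirectSum.decompose 𝒜 x i : ↥(𝒜 i)) : R) ∈ J)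

namespace EpiAux

variable {S : Type} [Ring S] [Algebra k S]

lemma exists_add (ℬ : ZMod 2 → Submodule k S) [GradedAlgebra ℬ] (s : S) :
    ∃ a ∈ ℬ 0, ∃ b ∈ ℬ 1, a + b = s := by
  have h : IsCompl (ℬ 0) (ℬ 1) :=
    (DirectSum.Decomposition.isInternal ℬ).isCompl (by decide) (by
      ext i; simp only [Set.mem_univ, true_iff, Set.mem_insert_iff, Set.mem_singleton_iff]; revert i; decide)
  have : s ∈ ℬ 0 ⊔ ℬ 1 := by rw [h.sup_eq_top]; trivial
  exact Submodule.mem_sup.1 this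

lemma dec0 (ℬ : ZMod 2 → Submodule k S) [GradedAlgebra ℬ] {a b : S}
    (ha : a ∈ ℬ 0) (hb : b ∈ ℬ 1) :
    ((DirectSum.decompose ℬ (a + b) 0 : ↥(ℬ 0)) : S) = a := by
  rw [DirectSum.decompose_add, DirectSum.add_apply, Submodule.coe_add,
    DirectSum.decompose_of_mem_same ℬ ha, DirectSum.decompose_of_mem_ne ℬ hb (by decide), add_zero]

lemma dec1 (ℬ : ZMod 2 → Submodule k S) [GradedAlgebra ℬ] {a b : S}
    (ha : a ∈ ℬ 0) (hb : b ∈ ℬ 1) :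
    ((DirectSum.decompose ℬ (a + b) 1 : ↥(ℬ 1)) : S) = b := by
  rw [DirectSum.decompose_add, DirectSum.add_apply, Submodule.coe_add,
    DirectSum.decompose_of_mem_same ℬ hb, DirectSum.decompose_of_mem_ne ℬ ha (by decide), zero_add]

/-- A sum of an even and an odd submodule is homogeneous. -/
lemma homog_of_sup (ℬ : ZMod 2 → Submodule k S) [GradedAlgebra ℬ] {J A B : Submodule k S}
    (hA : A ≤ ℬ 0) (hB : B ≤ ℬ 1) (hJ : J = A ⊔ B) :
    ∀ x ∈ J, ∀ i : ZMod 2, ((DirectSum.decompose ℬ x i : ↥(ℬ i)) : S) ∈ J := by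
  subst hJ
  intro x hx i
  obtain ⟨a, ha, b, hb, rfl⟩ := Submodule.mem_sup.1 hx
  fin_cases i
  · change ((DirectSum.decompose ℬ (a + b) 0 : ↥(ℬ 0)) : S) ∈ _
    rw [dec0 ℬ (hA ha) (hB hb)]
    exact Submodule.mem_sup_left ha
  · change ((DirectSum.decompose ℬ (a + b) 1 : ↥(ℬ 1)) : S) ∈ _
    rw [dec1 ℬ (hA ha) (hB hb)]
    exact Submodule.mem_sup_right hb

lemma isSuperIdeal_sup (ℬ : ZMod 2 → Submodule k S) [GradedAlgebra ℬ] {I J : Submodule k S}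
    (hI : IsSuperIdeal ℬ I) (hJ : IsSuperIdeal ℬ J) : IsSuperIdeal ℬ (I ⊔ J) := by
  obtain ⟨a1, a2, a3⟩ := hI
  obtain ⟨b1, b2, b3⟩ := hJ
  refine ⟨fun r x hx => ?_, fun r x hx => ?_, fun x hx i => ?_⟩ <;>
    obtain ⟨a, ha, b, hb, rfl⟩ := Submodule.mem_sup.1 hx
  · rw [mul_add]; exact Submodule.add_mem_sup (a1 r a ha) (b1 r b hb)
  · rw [add_mul]; exact Submodule.add_mem_sup (a2 r a ha) (b2 r b hb)
  · rw [DirectSum.decompose_add, DirectSum.add_apply, Submodule.coe_add]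
    exact Submodule.add_mem_sup (a3 a ha i) (b3 b hb i)

/-- The principal superideal generated by an odd element. -/
lemma principal (h2 : (2 : k) ≠ 0) (ℬ : ZMod 2 → Submodule k S) [GradedAlgebra ℬ]
    (hscS : ∀ (i j : ZMod 2) (a b : S), a ∈ ℬ i → b ∈ ℬ j →
      b * a = ((-1 : ℤ) ^ (i.val * j.val)) • (a * b)) {x : S} (hx : x ∈ ℬ 1) :
    ∃ X : Submodule k S, IsSuperIdeal ℬ X ∧ x ∈ X ∧ X * X = ⊥ := by
  have hxx : x * x = 0 := by
    have h := hscS 1 1 x x hx hx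
    have h1 : x * x = - (x * x) := by
      simpa [ZMod.val_one] using h
    have h3 : (2 : k) • (x * x) = 0 := by
      rw [two_smul]; nth_rewrite 1 [h1]; simp
    exact (smul_eq_zero.1 h3).resolve_left h2
  have hcomm : ∀ s : S, ∃ t : S, x * s = t * x := by
    intro s
    obtain ⟨a, ha, b, hb, rfl⟩ := exists_add ℬ s
    refine ⟨a - b, ?_⟩
    have h1 := hscS 0 1 a x ha hx
    have h3 := hscS 1 1 b x hb hx
    simp [ZMod.val_one] at h1 h3
    rw [mul_add, h1, h3, sub_mul, sub_eq_add_neg]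
  let X : Submodule k S := LinearMap.range (LinearMap.mulRight k x)
  have hX : ∀ y, y ∈ X ↔ ∃ s, s * x = y := fun y => Iff.rfl
  refine ⟨X, ⟨?_, ?_, ?_⟩, ⟨1, by simp⟩, ?_⟩
  · rintro r _ ⟨s, rfl⟩
    exact ⟨r * s, by simp [mul_assoc]⟩
  · rintro r _ ⟨s, rfl⟩
    obtain ⟨t, ht⟩ := hcomm r
    exact ⟨s * t, by simp [mul_assoc, ht]⟩
  · refine homog_of_sup ℬ (A := (ℬ 1).map (LinearMap.mulRight k x))
      (B := (ℬ 0).map (LinearMap.mulRight k x)) ?_ ?_ ?_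
    · rintro _ ⟨s, hs, rfl⟩
      exact SetLike.mul_mem_graded (i := (1 : ZMod 2)) (j := 1) hs hx
    · rintro _ ⟨s, hs, rfl⟩
      have := SetLike.mul_mem_graded (i := (0 : ZMod 2)) (j := 1) hs hx
      rwa [zero_add] at this
    · apply le_antisymm
      · rintro _ ⟨s, rfl⟩
        obtain ⟨a, ha, b, hb, rfl⟩ := exists_add ℬ s
        rw [map_add, add_comm]
        exact Submodule.add_mem_sup ⟨b, hb, rfl⟩ ⟨a, ha, rfl⟩
      · exact sup_le LinearMap.map_le_range LinearMap.map_le_range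
  · rw [eq_bot_iff, Submodule.mul_le]
    rintro _ ⟨s, rfl⟩ _ ⟨t, rfl⟩
    obtain ⟨u, hu⟩ := hcomm t
    have : s * x * (t * x) = 0 := by
      rw [mul_assoc, ← mul_assoc x, hu, mul_assoc u, hxx]; simp
    simpa using this

lemma nilp_sup {N X : Submodule k S} (h1 : ∀ r : S, ∀ x ∈ X, r * x ∈ X)
    (h2 : ∀ r : S, ∀ x ∈ X, x * r ∈ X) (hX : X * X = ⊥) {n : ℕ} (hN : N ^ n = ⊥) :
    (N ⊔ X) ^ (n + n) = ⊥ := by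
  have key : ∀ m, (N ⊔ X) ^ m ≤ N ^ m ⊔ X := by
    intro m
    induction m with
    | zero => simp
    | succ m ih =>
      rw [pow_succ, pow_succ]
      refine (mul_le_mul' ih le_rfl).trans ?_
      rw [Submodule.mul_sup, Submodule.sup_mul, Submodule.sup_mul]
      refine sup_le (sup_le le_sup_left (le_trans ?_ le_sup_right))
        (sup_le (le_trans ?_ le_sup_right) (le_trans ?_ le_sup_right))
      · exact Submodule.mul_le.2 fun a ha b hb => h2 b a ha
      · exact Submodule.mul_le.2 fun a ha b hb => h1 a b hb
      · exact Submodule.mul_le.2 fun a ha b hb => h1 a b hb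
  have := key n
  rw [hN, bot_sup_eq] at this
  rw [pow_add, eq_bot_iff, ← hX]
  exact mul_le_mul' this this

lemma exists_nilp (h2 : (2 : k) ≠ 0) (ℬ : ZMod 2 → Submodule k S) [GradedAlgebra ℬ]
    (hscS : ∀ (i j : ZMod 2) (a b : S), a ∈ ℬ i → b ∈ ℬ j →
      b * a = ((-1 : ℤ) ^ (i.val * j.val)) • (a * b))
    (hacc : ∀ c : ℕ → Submodule k S, (∀ n, IsSuperIdeal ℬ (c n)) → Monotone c →
      ∃ n, ∀ m, n ≤ m → c m = c n) :
    ∃ N : Submodule k S, IsSuperIdeal ℬ N ∧ ℬ 1 ≤ N ∧ ∃ n, N ^ n = ⊥ := by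
  have wf : WellFoundedGT {J : Submodule k S // IsSuperIdeal ℬ J} := by
    rw [wellFoundedGT_iff_monotone_chain_condition]
    intro c
    obtain ⟨n, hn⟩ := hacc (fun n => (c n).1) (fun n => (c n).2) (fun a b h => c.monotone h)
    exact ⟨n, fun m hm => Subtype.ext (hn m hm).symm⟩
  have hbot : IsSuperIdeal ℬ (⊥ : Submodule k S) := by
    refine ⟨?_, ?_, ?_⟩ <;> simp +contextual
  obtain ⟨⟨N, hN⟩, ⟨n, hn⟩, hmax⟩ := wf.wf.has_min
    {J : {J : Submodule k S // IsSuperIdeal ℬ J} | ∃ n, J.1 ^ n = ⊥}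
    ⟨⟨⊥, hbot⟩, 1, by simp⟩
  refine ⟨N, hN, fun x hx => ?_, n, hn⟩
  obtain ⟨X, hX, hxX, hXX⟩ := principal h2 ℬ hscS hx
  have hle : (⟨N, hN⟩ : {J : Submodule k S // IsSuperIdeal ℬ J}) ≤
    ⟨N ⊔ X, isSuperIdeal_sup ℬ hN hX⟩ := (le_sup_left : N ≤ N ⊔ X)
  have := hmax ⟨N ⊔ X, isSuperIdeal_sup ℬ hN hX⟩ ⟨n + n, nilp_sup hX.1 hX.2.1 hXX hn⟩
  have heq := hle.eq_of_not_lt this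
  have heq' : N = N ⊔ X := congrArg Subtype.val heq
  rw [heq']
  exact Submodule.mem_sup_right hxX

/-- If `J ≤ (F ⊓ J) ⊔ J²` with `J` nilpotent, then `J ≤ F`. -/
lemma le_of_nilp {F J : Submodule k S} (hF : F * F ≤ F) (hJJ : J * J ≤ J) (hJ : J ≤ (F ⊓ J) ⊔ J ^ 2)
    {n : ℕ} (hn : J ^ n = ⊥) : J ≤ F := by
  have key : ∀ m, J ^ (m + 1) ≤ (F ⊓ J ^ (m + 1)) ⊔ J ^ (m + 2) := by
    intro m
    induction m with
    | zero => simpa using hJ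
    | succ m ih =>
      rw [pow_succ J (m + 1)]
      refine (mul_le_mul' ih hJ).trans ?_
      rw [Submodule.mul_sup, Submodule.sup_mul, Submodule.sup_mul]
      refine sup_le (sup_le (le_trans ?_ le_sup_left) (le_trans ?_ le_sup_right))
        (sup_le (le_trans ?_ le_sup_right) (le_trans ?_ le_sup_right))
      · exact le_inf ((mul_le_mul' inf_le_left inf_le_left).trans hF)
          (mul_le_mul' inf_le_right inf_le_right)
      · refine (mul_le_mul' le_rfl inf_le_right).trans ?_
        rw [← pow_succ]
      · refine (mul_le_mul' inf_le_right le_rfl).trans ?_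
        rw [← pow_add]
      · rw [pow_succ J (m + 2)]
        exact mul_le_mul' le_rfl ((pow_two J).le.trans hJJ)
  have key2 : ∀ m, J ≤ F ⊔ J ^ (m + 1) := by
    intro m
    induction m with
    | zero => simp
    | succ m ih =>
      exact ih.trans (sup_le le_sup_left ((key m).trans (sup_le_sup_right inf_le_left _)))
  refine (key2 n).trans ?_
  rw [pow_succ, hn]; simp

/-- The quotient of a superalgebra by a homogeneous ideal, graded. -/
@[reducible] noncomputable def quotGraded (ℬ : ZMod 2 → Submodule k S) [GradedAlgebra ℬ]
    (K : Ideal S) [K.IsTwoSided]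
    (hK : ∀ x ∈ K, ∀ i : ZMod 2, ((DirectSum.decompose ℬ x i : ↥(ℬ i)) : S) ∈ K) :
    GradedAlgebra (fun i => (ℬ i).map (Ideal.Quotient.mkₐ k K).toLinearMap) :=
  let 𝒯 := fun i => (ℬ i).map (Ideal.Quotient.mkₐ k K).toLinearMap
  have hint : DirectSum.IsInternal 𝒯 := by
    rw [DirectSum.isInternal_submodule_iff_isCompl 𝒯 (i := 0) (j := 1) (by decide)
      (by ext i; simp only [Set.mem_univ, true_iff, Set.mem_insert_iff, Set.mem_singleton_iff]; revert i; decide)]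
    constructor
    · rw [Submodule.disjoint_def]
      rintro _ ⟨a, ha, rfl⟩ ⟨b, hb, hab⟩
      have h1 : a + -b ∈ K := by
        rw [← sub_eq_add_neg]; exact (Ideal.Quotient.eq).1 hab.symm
      have h3 := hK _ h1 0
      rw [dec0 ℬ ha (neg_mem hb)] at h3
      exact Ideal.Quotient.eq_zero_iff_mem.2 h3
    · rw [codisjoint_iff, eq_top_iff]
      intro y _
      obtain ⟨s, rfl⟩ := Ideal.Quotient.mkₐ_surjective k K y
      obtain ⟨a, ha, b, hb, rfl⟩ := exists_add ℬ s
      rw [map_add]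
      exact Submodule.add_mem_sup ⟨a, ha, rfl⟩ ⟨b, hb, rfl⟩
  { toDecomposition := hint.chooseDecomposition
    one_mem := ⟨1, SetLike.one_mem_graded ℬ, map_one (Ideal.Quotient.mkₐ k K)⟩
    mul_mem := by
      rintro i j _ _ ⟨a, ha, rfl⟩ ⟨b, hb, rfl⟩
      exact ⟨a * b, SetLike.mul_mem_graded ha hb, map_mul (Ideal.Quotient.mkₐ k K) _ _⟩ }

/-- Projection to the even part, modulo an ideal containing products of odd elements. -/
noncomputable def evenHom (ℬ : ZMod 2 → Submodule k S) [GradedAlgebra ℬ]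
    (K : Ideal S) [K.IsTwoSided] (hK : ∀ a ∈ ℬ 1, ∀ b ∈ ℬ 1, a * b ∈ K) :
    S →ₐ[k] S ⧸ K :=
  AlgHom.ofLinearMap ((Ideal.Quotient.mkₐ k K).toLinearMap ∘ₗ
      (ℬ 0).subtype ∘ₗ (DirectSum.component k _ _ 0) ∘ₗ
        (DirectSum.decomposeLinearEquiv ℬ).toLinearMap)
    (by
      change Ideal.Quotient.mk K ((DirectSum.decompose ℬ 1 0 : ↥(ℬ 0)) : S) = 1
      rw [DirectSum.decompose_of_mem_same ℬ (SetLike.one_mem_graded ℬ), map_one])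
    (by
      intro s t
      change Ideal.Quotient.mk K ((DirectSum.decompose ℬ (s * t) 0 : ↥(ℬ 0)) : S) =
        Ideal.Quotient.mk K ((DirectSum.decompose ℬ s 0 : ↥(ℬ 0)) : S) *
        Ideal.Quotient.mk K ((DirectSum.decompose ℬ t 0 : ↥(ℬ 0)) : S)
      obtain ⟨a, ha, b, hb, rfl⟩ := exists_add ℬ s
      obtain ⟨c, hc, d, hd, rfl⟩ := exists_add ℬ t
      have e : (a + b) * (c + d) = (a * c + b * d) + (a * d + b * c) := by noncomm_ring
      have m0 : a * c ∈ ℬ 0 := SetLike.mul_mem_graded (i := (0 : ZMod 2)) (j := 0) ha hc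
      have m1 : b * d ∈ ℬ 0 := SetLike.mul_mem_graded (i := (1 : ZMod 2)) (j := 1) hb hd
      have m2 : a * d ∈ ℬ 1 := SetLike.mul_mem_graded (i := (0 : ZMod 2)) (j := 1) ha hd
      have m3 : b * c ∈ ℬ 1 := SetLike.mul_mem_graded (i := (1 : ZMod 2)) (j := 0) hb hc
      rw [dec0 ℬ ha hb, dec0 ℬ hc hd, e, dec0 ℬ (add_mem m0 m1) (add_mem m2 m3), map_add, map_mul,
        Ideal.Quotient.eq_zero_iff_mem.2 (hK b hb d hd), add_zero])

lemma evenHom_apply (ℬ : ZMod 2 → Submodule k S) [GradedAlgebra ℬ]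
    (K : Ideal S) [K.IsTwoSided] (hK : ∀ a ∈ ℬ 1, ∀ b ∈ ℬ 1, a * b ∈ K) {a b : S}
    (ha : a ∈ ℬ 0) (hb : b ∈ ℬ 1) :
    evenHom ℬ K hK (a + b) = Ideal.Quotient.mk K a := by
  change Ideal.Quotient.mk K ((DirectSum.decompose ℬ (a + b) 0 : ↥(ℬ 0)) : S) = _
  rw [dec0 ℬ ha hb]

end EpiAux

theorem epi_of_superalgebras_is_surjective
    (h2 : (2 : k) ≠ 0)
    (R : Type) [Ring R] [Algebra k R]
    (𝒜 : ZMod 2 → Submodule k R) [GradedAlgebra 𝒜]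
    (hscR : ∀ (i j : ZMod 2) (a b : R), a ∈ 𝒜 i → b ∈ 𝒜 j →
      b * a = ((-1 : ℤ) ^ (i.val * j.val)) • (a * b))
    (S : Type) [Ring S] [Algebra k S]
    (ℬ : ZMod 2 → Submodule k S) [GradedAlgebra ℬ]
    (hscS : ∀ (i j : ZMod 2) (a b : S), a ∈ ℬ i → b ∈ ℬ j →
      b * a = ((-1 : ℤ) ^ (i.val * j.val)) • (a * b))
    -- `f` is a map of superalgebras
    (f : R →ₐ[k] S) (hfgr : ∀ (i : ZMod 2), ∀ a ∈ 𝒜 i, f a ∈ ℬ i)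
    -- `f` is an epimorphism in the category of supercommutative superalgebras
    (hepi : ∀ (T : Type) [Ring T] [Algebra k T]
      (𝒯 : ZMod 2 → Submodule k T), ∀ [GradedAlgebra 𝒯],
      (∀ (i j : ZMod 2) (a b : T), a ∈ 𝒯 i → b ∈ 𝒯 j →
        b * a = ((-1 : ℤ) ^ (i.val * j.val)) • (a * b)) →
      ∀ (g h : S →ₐ[k] T),
        (∀ (i : ZMod 2), ∀ a ∈ ℬ i, g a ∈ 𝒯 i) →
        (∀ (i : ZMod 2), ∀ a ∈ ℬ i, h a ∈ 𝒯 i) →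
        g.comp f = h.comp f → g = h)
    -- the induced map `R̄ → S̄` is surjective
    (hbar : ∀ s : S, ∃ r : R, s - f r ∈ oddIdeal ℬ)
    -- `S` is Noetherian: its super-ideals satisfy the ascending chain condition
    (hacc : ∀ c : ℕ → Submodule k S, (∀ n, IsSuperIdeal ℬ (c n)) → Monotone c →
      ∃ n, ∀ m, n ≤ m → c m = c n) :
    Function.Surjective f := by
  classical
  have g00 : ℬ 0 * ℬ 0 ≤ ℬ 0 := Submodule.mul_le.2 fun a ha b hb =>
    SetLike.mul_mem_graded (i := (0 : ZMod 2)) (j := 0) ha hb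
  have g01 : ℬ 0 * ℬ 1 ≤ ℬ 1 := Submodule.mul_le.2 fun a ha b hb =>
    SetLike.mul_mem_graded (i := (0 : ZMod 2)) (j := 1) ha hb
  have g10 : ℬ 1 * ℬ 0 ≤ ℬ 1 := Submodule.mul_le.2 fun a ha b hb =>
    SetLike.mul_mem_graded (i := (1 : ZMod 2)) (j := 0) ha hb
  have g11 : ℬ 1 * ℬ 1 ≤ ℬ 0 := Submodule.mul_le.2 fun a ha b hb =>
    SetLike.mul_mem_graded (i := (1 : ZMod 2)) (j := 1) ha hb
  have gtop : (⊤ : Submodule k S) = ℬ 0 ⊔ ℬ 1 := by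
    symm; rw [eq_top_iff]; intro s _
    obtain ⟨a, ha, b, hb, rfl⟩ := EpiAux.exists_add ℬ s
    exact Submodule.add_mem_sup ha hb
  -- the odd ideal
  obtain ⟨J, hJ⟩ : ∃ J : Submodule k S, J = ℬ 1 * ℬ 1 ⊔ ℬ 1 := ⟨_, rfl⟩
  have hJ1 : ℬ 1 ≤ J := hJ ▸ le_sup_right
  have hJ11 : ℬ 1 * ℬ 1 ≤ J := hJ ▸ le_sup_left
  have hJl : ⊤ * J ≤ J := by
    rw [gtop]
    nth_rewrite 1 [hJ]
    rw [Submodule.sup_mul, Submodule.mul_sup, Submodule.mul_sup]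
    refine sup_le (sup_le ?_ (g01.trans hJ1)) (sup_le ?_ hJ11)
    · rw [← mul_assoc]; exact (mul_le_mul' g01 le_rfl).trans hJ11
    · exact (mul_le_mul' le_rfl g11).trans (g10.trans hJ1)
  have hJr : J * ⊤ ≤ J := by
    rw [gtop]
    nth_rewrite 1 [hJ]
    rw [Submodule.mul_sup, Submodule.sup_mul, Submodule.sup_mul]
    refine sup_le (sup_le ?_ (g10.trans hJ1)) (sup_le ?_ hJ11)
    · rw [mul_assoc]; exact (mul_le_mul' le_rfl g10).trans hJ11
    · exact (mul_le_mul' g11 le_rfl).trans (g01.trans hJ1)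
  obtain ⟨F, hF⟩ : ∃ F : Submodule k S, F = LinearMap.range f.toLinearMap := ⟨_, rfl⟩
  obtain ⟨F0, hF0⟩ : ∃ F0 : Submodule k S, F0 = (𝒜 0).map f.toLinearMap := ⟨_, rfl⟩
  obtain ⟨F1, hF1⟩ : ∃ F1 : Submodule k S, F1 = (𝒜 1).map f.toLinearMap := ⟨_, rfl⟩
  have hFF : F * F ≤ F := by
    rw [hF, Submodule.mul_le]
    rintro _ ⟨a, rfl⟩ _ ⟨b, rfl⟩
    exact ⟨a * b, map_mul f a b⟩
  have hF1F : F1 ≤ F := by rw [hF, hF1]; exact LinearMap.map_le_range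
  have hF1B : F1 ≤ ℬ 1 := by
    rw [hF1]; rintro _ ⟨a, ha, rfl⟩; exact hfgr 1 a ha
  have hF01 : F ≤ F0 ⊔ F1 := by
    rw [hF, hF0, hF1]
    rintro _ ⟨r, rfl⟩
    obtain ⟨a, ha, b, hb, rfl⟩ := EpiAux.exists_add 𝒜 r
    rw [map_add]
    exact Submodule.add_mem_sup ⟨a, ha, rfl⟩ ⟨b, hb, rfl⟩
  have f01 : F0 * F1 ≤ F1 := by
    rw [hF0, hF1, Submodule.mul_le]
    rintro _ ⟨a, ha, rfl⟩ _ ⟨b, hb, rfl⟩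
    exact ⟨a * b, SetLike.mul_mem_graded (i := (0 : ZMod 2)) (j := 1) ha hb, map_mul f a b⟩
  have f10 : F1 * F0 ≤ F1 := by
    rw [hF0, hF1, Submodule.mul_le]
    rintro _ ⟨a, ha, rfl⟩ _ ⟨b, hb, rfl⟩
    exact ⟨a * b, SetLike.mul_mem_graded (i := (1 : ZMod 2)) (j := 0) ha hb, map_mul f a b⟩
  have hodd : oddIdeal ℬ ≤ J := by
    rw [oddIdeal, Submodule.span_le]
    rintro _ ⟨r, hr, a, b, rfl⟩
    exact hJr (Submodule.mul_mem_mul (hJl (Submodule.mul_mem_mul trivial (hJ1 hr))) trivial)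
  have hFJ : (⊤ : Submodule k S) ≤ F ⊔ J := by
    intro s _
    obtain ⟨r, hr⟩ := hbar s
    have : f r + (s - f r) ∈ F ⊔ J :=
      Submodule.add_mem_sup (hF ▸ ⟨r, rfl⟩) (hodd hr)
    simpa using this
  have htop3 : (⊤ : Submodule k S) ≤ F0 ⊔ F1 ⊔ J := hFJ.trans (sup_le_sup_right hF01 _)
  -- the ideal `K`
  obtain ⟨K, hK⟩ : ∃ K : Submodule k S, K = J * J ⊔ F1 := ⟨_, rfl⟩
  have hKl : ⊤ * K ≤ K := by
    rw [hK, Submodule.mul_sup]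
    refine sup_le ?_ ?_
    · rw [← mul_assoc]; exact (mul_le_mul' hJl le_rfl).trans le_sup_left
    · refine (mul_le_mul' htop3 le_rfl).trans ?_
      rw [Submodule.sup_mul, Submodule.sup_mul]
      exact sup_le (sup_le (f01.trans le_sup_right)
        ((mul_le_mul' (hF1B.trans hJ1) (hF1B.trans hJ1)).trans le_sup_left))
        ((mul_le_mul' le_rfl (hF1B.trans hJ1)).trans le_sup_left)
  have hKr : K * ⊤ ≤ K := by
    rw [hK, Submodule.sup_mul]
    refine sup_le ?_ ?_
    · rw [mul_assoc]; exact (mul_le_mul' le_rfl hJr).trans le_sup_left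
    · refine (mul_le_mul' le_rfl htop3).trans ?_
      rw [Submodule.mul_sup, Submodule.mul_sup]
      exact sup_le (sup_le (f10.trans le_sup_right)
        ((mul_le_mul' (hF1B.trans hJ1) (hF1B.trans hJ1)).trans le_sup_left))
        ((mul_le_mul' (hF1B.trans hJ1) le_rfl).trans le_sup_left)
  have hKhom : ∀ x ∈ K, ∀ i : ZMod 2, ((DirectSum.decompose ℬ x i : ↥(ℬ i)) : S) ∈ K := by
    refine EpiAux.homog_of_sup ℬ
      (A := (ℬ 1 * ℬ 1) * (ℬ 1 * ℬ 1) ⊔ ℬ 1 * ℬ 1)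
      (B := (ℬ 1 * (ℬ 1 * ℬ 1) ⊔ (ℬ 1 * ℬ 1) * ℬ 1) ⊔ F1) ?_ ?_ ?_
    · exact sup_le ((mul_le_mul' g11 g11).trans g00) g11
    · exact sup_le (sup_le ((mul_le_mul' le_rfl g11).trans g10)
        ((mul_le_mul' g11 le_rfl).trans g01)) hF1B
    · rw [hK, hJ, Submodule.mul_sup, Submodule.sup_mul, Submodule.sup_mul]
      ac_rfl
  let KI : Ideal S :=
    { carrier := K
      add_mem' := fun ha hb => K.add_mem ha hb
      zero_mem' := K.zero_mem
      smul_mem' := fun c x hx => hKl (Submodule.mul_mem_mul trivial hx) }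
  have : KI.IsTwoSided := ⟨fun {a} b ha => hKr (Submodule.mul_mem_mul (ha : a ∈ K) trivial)⟩
  have h11 : ∀ a ∈ ℬ 1, ∀ b ∈ ℬ 1, a * b ∈ KI := fun a ha b hb => by
    change a * b ∈ K
    rw [hK]
    exact Submodule.mem_sup_left (Submodule.mul_mem_mul (hJ1 ha) (hJ1 hb))
  letI := EpiAux.quotGraded ℬ KI hKhom
  have heq := hepi (S ⧸ KI) (fun i => (ℬ i).map (Ideal.Quotient.mkₐ k KI).toLinearMap)
    (by
      rintro i j _ _ ⟨a, ha, rfl⟩ ⟨b, hb, rfl⟩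
      have := congrArg (Ideal.Quotient.mkₐ k KI) (hscS i j a b ha hb)
      rw [map_mul, map_zsmul, map_mul] at this
      exact this)
    (Ideal.Quotient.mkₐ k KI) (EpiAux.evenHom ℬ KI h11)
    (fun i a ha => ⟨a, ha, rfl⟩)
    (by
      intro i a ha
      fin_cases i
      · have := EpiAux.evenHom_apply ℬ KI h11 (a := a) ha (zero_mem _)
        rw [add_zero] at this
        rw [this]
        exact ⟨a, ha, rfl⟩
      · have := EpiAux.evenHom_apply ℬ KI h11 (b := a) (zero_mem _) ha
        rw [zero_add, map_zero] at this
        rw [this]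
        exact zero_mem _)
    (by
      ext r
      obtain ⟨a, ha, b, hb, rfl⟩ := EpiAux.exists_add 𝒜 r
      rw [AlgHom.comp_apply, AlgHom.comp_apply, map_add f,
        EpiAux.evenHom_apply ℬ KI h11 (hfgr 0 a ha) (hfgr 1 b hb), map_add]
      have hb0 : Ideal.Quotient.mk KI (f b) = 0 := by
        refine Ideal.Quotient.eq_zero_iff_mem.2 ?_
        change f b ∈ K
        rw [hK, hF1]
        exact Submodule.mem_sup_right ⟨b, hb, rfl⟩
      rw [Ideal.Quotient.mkₐ_eq_mk, hb0, add_zero])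
  have hB1 : ℬ 1 ≤ K := by
    intro b hb
    have h1 := EpiAux.evenHom_apply ℬ KI h11 (zero_mem _) hb
    rw [zero_add, map_zero, ← heq, Ideal.Quotient.mkₐ_eq_mk, Ideal.Quotient.eq_zero_iff_mem] at h1
    exact h1
  obtain ⟨N, hN, hN1, n, hn⟩ := EpiAux.exists_nilp h2 ℬ hscS hacc
  have hJN : J ≤ N := by
    rw [hJ]
    exact sup_le (Submodule.mul_le.2 fun a ha b hb => hN.1 a b (hN1 hb)) hN1
  have hJn : J ^ n = ⊥ := by
    rw [eq_bot_iff, ← hn]; exact pow_le_pow_left' hJN n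
  have hJF : J ≤ F := by
    refine EpiAux.le_of_nilp hFF ((mul_le_mul' le_top le_rfl).trans hJl) ?_ hJn
    nth_rewrite 1 [hJ]
    rw [pow_two]
    refine sup_le ((mul_le_mul' hJ1 hJ1).trans le_sup_right) (hB1.trans ?_)
    rw [hK]
    exact sup_le le_sup_right ((le_inf hF1F (hF1B.trans hJ1)).trans le_sup_left)
  intro s
  have : s ∈ F := (sup_le le_rfl hJF) (hFJ (trivial : s ∈ (⊤ : Submodule k S)))
  rw [hF] at this
  exact this
end

section
/- Let R → S be a faithfully flat homomorphism of commutative Noetherian local rings. If S is regular, then R is regular. -/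
/-!
STATEMENT 18: If `R → S` is a faithfully flat homomorphism of commutative Noetherian
local rings and `S` is regular, then `R` is regular.

Regularity of a Noetherian local ring is expressed in the standard way: the maximal
ideal is generated by `d` elements, where `d` is the Krull dimension.
-/

/-- A commutative Noetherian local ring is regular if its maximal ideal can be generated
by Krull-dimension many elements. -/
def IsRegularLocal (R : Type*) [CommRing R] [IsLocalRing R] : Prop :=
  IsNoetherianRing R ∧
    ∃ s : Finset R, Ideal.span (↑s : Set R) = IsLocalRing.maximalIdeal R ∧
      (s.card : WithBot (WithTop ℕ)) = ringKrullDim R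

namespace RegDescent
open CategoryTheory IsLocalRing RingTheory.Sequence TensorProduct
universe u v w


/-- Projective dimension at most `n`, for unbundled modules. -/
def PdLE (R : Type u) [CommRing R] (M : Type u) [AddCommGroup M] [Module R M] (n : ℕ) : Prop :=
  HasProjectiveDimensionLE (ModuleCat.of R M) n

section pd
variable {R : Type u} [CommRing R] {M N : Type u} [AddCommGroup M] [Module R M]
  [AddCommGroup N] [Module R N]

lemma pdLE_zero_iff : PdLE R M 0 ↔ Module.Projective R M := by
  unfold PdLE
  rw [← projective_iff_hasProjectiveDimensionLE_zero, ← IsProjective.iff_projective]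

lemma pdLE_succ_iff {F : Type u} [AddCommGroup F] [Module R F] [Module.Projective R F]
    {f : F →ₗ[R] M} (hf : Function.Surjective f) (n : ℕ) :
    PdLE R M (n + 1) ↔ PdLE R (LinearMap.ker f) n := by
  have h := LinearMap.shortExact_shortComplexKer hf
  exact h.hasProjectiveDimensionLT_X₃_iff n
    ((IsProjective.iff_projective F).mp inferInstance)

lemma PdLE.retract {n : ℕ} (h : PdLE R N n) (i : M →ₗ[R] N) (p : N →ₗ[R] M)
    (hip : p ∘ₗ i = LinearMap.id) : PdLE R M n := by
  unfold PdLE at *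
  let r : Retract (ModuleCat.of R M) (ModuleCat.of R N) :=
    { i := ModuleCat.ofHom i, r := ModuleCat.ofHom p
      retract := by rw [← ModuleCat.ofHom_comp, hip]; rfl }
  exact r.hasProjectiveDimensionLT (n + 1)

lemma PdLE.mono {m n : ℕ} (h : PdLE R M m) (hmn : m ≤ n) : PdLE R M n := by
  unfold PdLE at *
  exact hasProjectiveDimensionLT_of_ge _ (m + 1) (n + 1) (by lia)

lemma PdLE.equiv {n : ℕ} (h : PdLE R N n) (e : M ≃ₗ[R] N) : PdLE R M n :=
  h.retract e.toLinearMap e.symm.toLinearMap (by ext; simp)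

end pd

/-- `x` regular on `M`: reduction mod `x` does not increase projective dimension. -/
lemma PdLE.quotSMulTop {R : Type u} [CommRing R] [IsNoetherianRing R] (x : R)
    (hxR : IsSMulRegular R x) (n : ℕ) :
    ∀ (M : Type u) [AddCommGroup M] [Module R M] [Module.Finite R M], IsSMulRegular M x →
      PdLE R M n → PdLE (R ⧸ Ideal.span {x}) (QuotSMulTop x M) n := by
  induction n with
  | zero =>
    intro M _ _ _ _ h
    rw [pdLE_zero_iff] at h ⊢
    exact Module.Projective.of_equiv ((QuotSMulTop.equivQuotTensor x M).extendScalarsOfSurjective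
      Ideal.Quotient.mk_surjective).symm
  | succ n ih =>
    intro M _ _ _ hM h
    obtain ⟨k, f, hf⟩ := Module.Finite.exists_fin' R M
    rw [pdLE_succ_iff hf] at h
    have hF : IsSMulRegular (Fin k → R) x := IsSMulRegular.pi fun _ => hxR
    have hK : IsSMulRegular (LinearMap.ker f) x := hF.submodule _ x
    have h' := ih _ hK h
    have hex : Function.Exact (LinearMap.ker f).subtype f := f.exact_subtype_ker_map
    have ex1 := QuotSMulTop.map_exact x hex hf
    have inj : Function.Injective (QuotSMulTop.map x (LinearMap.ker f).subtype) := by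
      have h0 : Function.Exact (0 : PUnit.{u+1} →ₗ[R] LinearMap.ker f) (LinearMap.ker f).subtype := by
        rw [LinearMap.exact_zero_iff_injective]; exact Submodule.injective_subtype _
      have := QuotSMulTop.map_first_exact_on_four_term_exact_of_isSMulRegular_last h0 hex hM
      rw [map_zero, LinearMap.exact_zero_iff_injective] at this
      exact this
    let g := (QuotSMulTop.map x f).extendScalarsOfSurjective
      (S := R ⧸ Ideal.span {x}) Ideal.Quotient.mk_surjective
    let j := (QuotSMulTop.map x (LinearMap.ker f).subtype).extendScalarsOfSurjective
      (S := R ⧸ Ideal.span {x}) Ideal.Quotient.mk_surjective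
    have hg : Function.Surjective g := QuotSMulTop.map_surjective x hf
    rw [pdLE_succ_iff hg]
    have hj : Function.Injective j := inj
    have hr : LinearMap.ker g = LinearMap.range j := (LinearMap.exact_iff (f := j) (g := g)).mp ex1
    exact h'.equiv ((LinearEquiv.ofEq _ _ hr).trans (LinearEquiv.ofInjective j hj).symm)

/-- Over a local ring of depth zero, finite projective dimension implies free. -/
lemma free_of_pdLE_of_socle {R : Type u} [CommRing R] [IsLocalRing R] [IsNoetherianRing R]
    (s : R) (hs : s ≠ 0) (hsm : ∀ a ∈ maximalIdeal R, s * a = 0) (n : ℕ) :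
    ∀ (M : Type u) [AddCommGroup M] [Module R M] [Module.Finite R M],
      PdLE R M n → Module.Free R M := by
  induction n with
  | zero =>
    intro M _ _ _ h
    rw [pdLE_zero_iff] at h
    exact Module.free_of_flat_of_isLocalRing
  | succ n ih =>
    intro M _ _ _ h
    let w := Module.Free.chooseBasis (ResidueField R) (ResidueField R ⊗[R] M)
    obtain ⟨v, eq⟩ := (TensorProduct.mk_surjective R M (ResidueField R)
      Ideal.Quotient.mk_surjective).comp_left w
    have hsp := span_eq_top_of_tmul_eq_basis v w (congr_fun eq)
    let f := Fintype.linearCombination R v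
    have hf : Function.Surjective f := by
      rw [← LinearMap.range_eq_top, Fintype.range_linearCombination, hsp]
    rw [pdLE_succ_iff hf] at h
    have hfree := ih _ h
    have hker : ∀ a ∈ LinearMap.ker f, s • a = 0 := by
      intro a ha
      funext i
      refine hsm _ ?_
      have h1 : ∑ i, residue R (a i) • w i = 0 := by
        have h2 : TensorProduct.mk R (ResidueField R) M 1 (f a) = 0 := by
          rw [LinearMap.mem_ker.mp ha, map_zero]
        simp only [f, Fintype.linearCombination_apply, map_sum, map_smul] at h2
        rw [← h2]
        refine Finset.sum_congr rfl fun i _ => ?_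
        rw [← congr_fun eq i]
        rw [← algebraMap_smul (ResidueField R) (a i)]
        rfl
      have := Fintype.linearIndependent_iff.mp w.linearIndependent _ h1 i
      rwa [residue_eq_zero_iff] at this
    have hsub : Subsingleton (LinearMap.ker f) := by
      by_contra hc
      rw [not_subsingleton_iff_nontrivial] at hc
      have : s ∈ Module.annihilator R (LinearMap.ker f) :=
        Module.mem_annihilator.mpr fun a => Subtype.ext (hker a.1 a.2)
      rw [Module.annihilator_eq_bot.mpr inferInstance] at this
      exact hs this
    have hinj : Function.Injective f := LinearMap.ker_eq_bot.mp
      ((Submodule.subsingleton_iff_eq_bot).mp hsub)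
    exact Module.Free.of_equiv (LinearEquiv.ofBijective f ⟨hinj, hf⟩)

/-- Regularity shift along a short exact sequence. -/
lemma isWeaklyRegular_ker {S : Type u} [CommRing S] (y : S) (rs : List S) :
    ∀ (K : Type v) (F : Type v) (M : Type v) [AddCommGroup K] [AddCommGroup F] [AddCommGroup M]
      [Module S K] [Module S F] [Module S M] (f : K →ₗ[S] F) (g : F →ₗ[S] M),
      Function.Injective f → Function.Exact f g → Function.Surjective g →
      IsWeaklyRegular M rs → IsWeaklyRegular F (rs ++ [y]) → IsWeaklyRegular K (rs ++ [y]) := by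
  induction rs with
  | nil =>
    intro K F M _ _ _ _ _ _ f g hf hex hg hM hF
    simp only [List.nil_append, isWeaklyRegular_singleton_iff] at *
    exact hF.of_injective f hf
  | cons x rs ih =>
    intro K F M _ _ _ _ _ _ f g hf hex hg hM hF
    simp only [List.cons_append, isWeaklyRegular_cons_iff] at *
    refine ⟨hF.1.of_injective f hf, ih _ _ _ (QuotSMulTop.map x f) (QuotSMulTop.map x g) ?_
      (QuotSMulTop.map_exact x hex hg) (QuotSMulTop.map_surjective x hg) hM.2 hF.2⟩
    have h0 : Function.Exact (0 : PUnit.{v+1} →ₗ[S] K) f := by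
      rw [LinearMap.exact_zero_iff_injective]; exact hf
    have := QuotSMulTop.map_first_exact_on_four_term_exact_of_isSMulRegular_last h0 hex hM.1
    rw [map_zero, LinearMap.exact_zero_iff_injective] at this
    exact this

/-- A quotient of a local ring by an element of the maximal ideal is local. -/
lemma isLocalRing_quot {S : Type u} [CommRing S] [IsLocalRing S] {x : S}
    (hx : x ∈ maximalIdeal S) : IsLocalRing (S ⧸ Ideal.span {x}) := by
  have : Nontrivial (S ⧸ Ideal.span {x}) := Ideal.Quotient.nontrivial_iff.mpr fun h =>
    (maximalIdeal.isMaximal S).ne_top (top_le_iff.mp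
      (h ▸ (Ideal.span_singleton_le_iff_mem _).mpr hx))
  exact IsLocalRing.of_surjective' _ Ideal.Quotient.mk_surjective

lemma map_maximalIdeal_quot {S : Type u} [CommRing S] [IsLocalRing S] (x : S)
    [IsLocalRing (S ⧸ Ideal.span {x})] :
    (maximalIdeal S).map (Ideal.Quotient.mk (Ideal.span {x})) =
      maximalIdeal (S ⧸ Ideal.span {x}) := by
  have := IsLocalHom.of_surjective (Ideal.Quotient.mk (Ideal.span {x}))
    Ideal.Quotient.mk_surjective
  refine le_antisymm (((local_hom_TFAE _).out 0 2).mp this) ?_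
  intro a ha
  obtain ⟨b, rfl⟩ := Ideal.Quotient.mk_surjective a
  refine Ideal.mem_map_of_mem _ ?_
  by_contra hb
  rw [mem_maximalIdeal, mem_nonunits_iff, not_not] at hb
  exact ha (hb.map _)

/-- A finite module on which a generating sequence of the maximal ideal is weakly regular is
free. -/
lemma free_of_isWeaklyRegular (n : ℕ) :
    ∀ (S : Type u) [CommRing S] [IsLocalRing S] [IsNoetherianRing S] (rs : List S),
    rs.length = n → Ideal.ofList rs = maximalIdeal S →
    ∀ (N : Type v) [AddCommGroup N] [Module S N] [Module.Finite S N],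
      IsWeaklyRegular N rs → Module.Free S N := by
  induction n with
  | zero =>
    intro S _ _ _ rs hl hm N _ _ _ _
    obtain rfl := List.length_eq_zero_iff.mp hl
    have hS : IsField S := by
      rw [isField_iff_maximalIdeal_eq, ← hm, Ideal.ofList_nil]
    let := hS.toField
    exact Module.Free.of_divisionRing S N
  | succ n ih =>
    intro S _ _ _ rs hl hm N _ _ _ h
    obtain ⟨x, rs, rfl⟩ := List.exists_cons_of_length_eq_add_one hl
    have hx : x ∈ maximalIdeal S := by
      rw [← hm, Ideal.ofList_cons]
      exact Ideal.mem_sup_left (Ideal.mem_span_singleton_self x)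
    have := isLocalRing_quot hx
    rw [isWeaklyRegular_cons_iff'] at h
    have := Module.finitePresentation_of_finite S N
    refine (Module.free_quotSMulTop_iff_free S N (x := x) ?_ h.1).mp ?_
    · rwa [IsLocalRing.jacobson_eq_maximalIdeal _ bot_ne_top]
    · have := Module.Finite.of_restrictScalars_finite S (S ⧸ Ideal.span {x}) (QuotSMulTop x N)
      refine ih _ (rs.map (Ideal.Quotient.mk (Ideal.span {x}))) (by simpa using hl) ?_ _ h.2
      rw [← map_maximalIdeal_quot, ← hm, Ideal.ofList_cons, Ideal.map_sup, Ideal.map_ofList]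
      simp [Ideal.map_span]

lemma free_descent {R : Type u} {S : Type v} [CommRing R] [CommRing S] [IsLocalRing R]
    [Algebra R S] [Module.FaithfullyFlat R S] (M : Type u) [AddCommGroup M] [Module R M]
    [Module.Finite R M] [Module.Free S (S ⊗[R] M)] : Module.Free R M := by
  have hfl : Module.Flat R (S ⊗[R] M) := Module.Flat.trans R S _
  have : Module.Flat R M := by
    rw [Module.Flat.iff_lTensor_preserves_injective_linearMap]
    intro N N' _ _ _ _ f hf
    rw [← Module.FaithfullyFlat.lTensor_injective_iff_injective R S]
    have h1 := Module.Flat.lTensor_preserves_injective_linearMap (M := S ⊗[R] M) f hf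
    rw [LinearMap.lTensor_tensor] at h1
    simpa using h1
  exact Module.free_of_flat_of_isLocalRing

lemma pdLE_descent {R : Type u} {S : Type v} [CommRing R] [CommRing S] [IsLocalRing R]
    [IsLocalRing S] [IsNoetherianRing R] [IsNoetherianRing S]
    [Algebra R S] [Module.FaithfullyFlat R S] (rs : List S) (hrs : IsWeaklyRegular S rs)
    (hm : Ideal.ofList rs = maximalIdeal S) (n : ℕ) :
    ∀ i, i + n = rs.length → ∀ (M : Type u) [AddCommGroup M] [Module R M] [Module.Finite R M],
      IsWeaklyRegular (S ⊗[R] M) (rs.take i) → PdLE R M n := by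
  induction n with
  | zero =>
    intro i hi M _ _ _ h
    rw [List.take_of_length_le (by lia)] at h
    have := free_of_isWeaklyRegular _ S rs rfl hm _ h
    have := free_descent (S := S) M (R := R)
    rw [pdLE_zero_iff]; infer_instance
  | succ n ih =>
    intro i hi M _ _ _ h
    obtain ⟨k, f, hf⟩ := Module.Finite.exists_fin' R M
    rw [pdLE_succ_iff hf]
    refine ih (i + 1) (by lia) _ ?_
    have hlt : i < rs.length := by lia
    rw [← List.take_append_getElem hlt]
    refine isWeaklyRegular_ker _ _ _ _ _ ((LinearMap.ker f).subtype.baseChange S)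
      (f.baseChange S) ?_ ?_ ?_ h ?_
    · exact Module.Flat.lTensor_preserves_injective_linearMap (M := S) _
        (Submodule.injective_subtype _)
    · exact lTensor_exact S f.exact_subtype_ker_map hf
    · exact LinearMap.lTensor_surjective S hf
    · rw [List.take_append_getElem hlt]
      have h1 := hrs.isWeaklyRegular_lTensor (M₂ := S ⊗[R] (Fin k → R))
      rw [LinearEquiv.isWeaklyRegular_congr (TensorProduct.rid S _)] at h1
      rw [← List.take_append_drop (i + 1) rs, isWeaklyRegular_append_iff] at h1
      exact h1.1


/-- The maximal ideal is generated by a regular sequence. -/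
def HasRegGen (S : Type u) [CommRing S] [IsLocalRing S] : Prop :=
  ∃ rs : List S, IsWeaklyRegular S rs ∧ Ideal.ofList rs = maximalIdeal S

lemma HasRegGen.cons {S : Type u} [CommRing S] [IsLocalRing S] {x : S}
    (hx : x ∈ maximalIdeal S) (hreg : IsSMulRegular S x) [IsLocalRing (S ⧸ Ideal.span {x})]
    (h : HasRegGen (S ⧸ Ideal.span {x})) : HasRegGen S := by
  obtain ⟨rs, h1, h2⟩ := h
  obtain ⟨rs, rfl⟩ := List.map_surjective_iff.mpr
    (Ideal.Quotient.mk_surjective (I := Ideal.span {x})) rs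
  refine ⟨x :: rs, ?_, ?_⟩
  · rw [isWeaklyRegular_cons_iff]
    refine ⟨hreg, ?_⟩
    have h3 := (isWeaklyRegular_map_algebraMap_iff (S ⧸ Ideal.span {x}) (S ⧸ Ideal.span {x})
      rs).mp h1
    refine (LinearEquiv.isWeaklyRegular_congr (Submodule.quotEquivOfEq _ _ ?_) rs).mpr h3
    rw [← Submodule.ideal_span_singleton_smul]
    simp
  · have hc : Ideal.ofList (x :: rs) ≤ maximalIdeal S ∧ True := by
      refine ⟨?_, trivial⟩
      rw [Ideal.ofList_cons, sup_le_iff, Ideal.span_singleton_le_iff_mem]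
      refine ⟨hx, ?_⟩
      rw [← Ideal.map_ofList, ← map_maximalIdeal_quot] at h2
      refine (Ideal.le_comap_map.trans (Ideal.comap_mono h2.le)).trans ?_
      rw [Ideal.comap_map_of_surjective _ Ideal.Quotient.mk_surjective, ← RingHom.ker,
        Ideal.mk_ker, sup_le_iff, Ideal.span_singleton_le_iff_mem]
      exact ⟨le_rfl, hx⟩
    refine le_antisymm hc.1 ?_
    rw [← Ideal.map_ofList, ← map_maximalIdeal_quot] at h2
    refine (Ideal.le_comap_map.trans (Ideal.comap_mono h2.ge)).trans ?_
    rw [Ideal.comap_map_of_surjective _ Ideal.Quotient.mk_surjective, ← RingHom.ker,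
        Ideal.mk_ker, sup_comm, Ideal.ofList_cons]

lemma spanFinrank_quot {S : Type u} [CommRing S] [IsLocalRing S] [IsNoetherianRing S] {x : S}
    (hx : x ∈ maximalIdeal S) (hx2 : x ∉ maximalIdeal S ^ 2) [IsLocalRing (S ⧸ Ideal.span {x})] :
    (maximalIdeal (S ⧸ Ideal.span {x})).spanFinrank + 1 ≤ (maximalIdeal S).spanFinrank := by
  set m := maximalIdeal S
  set xb : CotangentSpace S := m.toCotangent ⟨x, hx⟩ with hxb
  have hxb0 : xb ≠ 0 := by
    rw [hxb, Ne, Ideal.toCotangent_eq_zero]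
    exact hx2
  let W := Submodule.span (ResidueField S) {xb}
  have hW : Module.finrank (ResidueField S) W = 1 := finrank_span_singleton hxb0
  have hq := Submodule.finrank_quotient_add_finrank W
  rw [hW, ← spanFinrank_maximalIdeal_eq_finrank_cotangentSpace] at hq
  rw [← hq]
  gcongr
  let b := Module.finBasis (ResidueField S) (CotangentSpace S ⧸ W)
  have hy : ∀ i, ∃ y : m, W.mkQ (m.toCotangent y) = b i := fun i => by
    obtain ⟨v, hv⟩ := W.mkQ_surjective (b i)
    obtain ⟨y, rfl⟩ := m.toCotangent_surjective v
    exact ⟨y, hv⟩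
  choose y hy using hy
  have htop : Submodule.span (ResidueField S)
      (m.toCotangent '' (insert ⟨x, hx⟩ (Set.range y))) = ⊤ := by
    rw [Set.image_insert_eq, Submodule.span_insert]
    change W ⊔ _ = ⊤
    have key : ∀ U : Submodule (ResidueField S) (CotangentSpace S),
        U.map W.mkQ = ⊤ → W ⊔ U = ⊤ := by
      intro U hU
      have h1 := Submodule.comap_map_eq W.mkQ U
      rw [hU, Submodule.comap_top, Submodule.ker_mkQ, sup_comm] at h1
      exact h1.symm
    refine key _ ?_
    rw [Submodule.map_span, ← Set.range_comp, ← Set.range_comp]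
    have : (W.mkQ ∘ m.toCotangent ∘ y) = b := funext hy
    rw [this, b.span_eq]
  rw [CotangentSpace.span_image_eq_top_iff] at htop
  have hm : m = Ideal.span (insert x (Set.range fun i => (y i : S))) := by
    have := congrArg (Submodule.map m.subtype) htop
    rw [Submodule.map_span, Submodule.map_subtype_top, Set.image_insert_eq, ← Set.range_comp] at this
    exact this.symm
  have hm' : maximalIdeal (S ⧸ Ideal.span {x}) =
      Ideal.span (Set.range fun i => Ideal.Quotient.mk (Ideal.span {x}) (y i : S)) := by
    rw [← map_maximalIdeal_quot]
    refine (congrArg (Ideal.map _) hm).trans ?_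
    rw [Ideal.map_span, Set.image_insert_eq, ← Set.range_comp, Ideal.span_insert]
    simp [Function.comp_def]
  rw [hm']
  refine (Submodule.spanFinrank_span_le_ncard_of_finite (Set.finite_range _)).trans ?_
  rw [← Set.image_univ]
  refine (Set.ncard_image_le).trans ?_
  simp

lemma exists_avoid {S : Type u} [CommRing S] [IsLocalRing S] [IsNoetherianRing S]
    (hm : maximalIdeal S ≠ ⊥) (T : Set (Ideal S)) (hT : T.Finite) (hp : ∀ P ∈ T, P.IsPrime)
    (hle : ∀ P ∈ T, ¬ maximalIdeal S ≤ P) :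
    ∃ x ∈ maximalIdeal S, x ∉ maximalIdeal S ^ 2 ∧ ∀ P ∈ T, x ∉ P := by
  by_contra! hcon
  have h := (Ideal.subset_union_prime_finite (hT.insert (maximalIdeal S ^ 2)) (f := id)
    (maximalIdeal S ^ 2) (maximalIdeal S ^ 2) (by
      rintro P (rfl | hP) h1 h2
      · exact absurd rfl h1
      · exact hp _ hP) (I := maximalIdeal S)).mp (by
      intro x hx
      by_cases h2 : x ∈ maximalIdeal S ^ 2
      · exact Set.mem_biUnion (Set.mem_insert _ _) h2
      · obtain ⟨P, hP, hxP⟩ := hcon x hx h2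
        exact Set.mem_biUnion (Set.mem_insert_of_mem _ hP) hxP)
  obtain ⟨P, rfl | hP, h⟩ := h
  · refine hm (Submodule.eq_bot_of_le_smul_of_le_jacobson_bot (maximalIdeal S) _
      (IsNoetherian.noetherian _) ?_ ?_)
    · rw [smul_eq_mul, ← pow_two]; exact h
    · rw [IsLocalRing.jacobson_eq_maximalIdeal _ bot_ne_top]
  · exact hle P hP h

lemma withBot_cancel {d : ℕ} {a : WithBot ℕ∞} (h : ((d + 1 : ℕ) : WithBot ℕ∞) ≤ a + 1) :
    (d : WithBot ℕ∞) ≤ a := by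
  induction a with
  | bot => simp at h
  | coe a =>
    induction a with
    | top => exact le_top
    | coe a =>
      have h1 : d + 1 ≤ a + 1 := by exact_mod_cast h
      have h2 : d ≤ a := by lia
      exact_mod_cast h2

lemma regular_aux (d : ℕ) : ∀ (S : Type u) [CommRing S] [IsLocalRing S] [IsNoetherianRing S],
    ringKrullDim S = d → (maximalIdeal S).spanFinrank ≤ d → IsDomain S ∧ HasRegGen S := by
  induction d with
  | zero =>
    intro S _ _ _ hd hs
    have hm : maximalIdeal S = ⊥ := (Submodule.spanFinrank_eq_zero_iff_eq_bot
      (IsNoetherian.noetherian _)).mp (by lia)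
    refine ⟨(isField_iff_maximalIdeal_eq.mpr hm).isDomain, [], by simp, ?_⟩
    rw [hm, Ideal.ofList_nil]
  | succ d ih =>
    intro S _ _ _ hd hs
    have hmin : ∀ P ∈ minimalPrimes S, ¬ maximalIdeal S ≤ P := by
      intro P hP hle
      have hPp : P.IsPrime := hP.1.1
      have hPm : P = maximalIdeal S := le_antisymm (le_maximalIdeal hPp.ne_top) hle
      have h0 : (maximalIdeal S).height = 0 := by
        rw [Ideal.height_eq_zero_iff, ← hPm]
        exact hP
      have := maximalIdeal_height_eq_ringKrullDim (R := S)
      rw [h0, hd] at this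
      norm_cast at this
    have hbot : maximalIdeal S ≠ ⊥ := by
      intro h
      obtain ⟨P, hP⟩ := Ideal.nonempty_minimalPrimes (bot_ne_top (α := Ideal S))
      exact hmin P hP (h ▸ bot_le)
    obtain ⟨x, hx, hx2, hxP⟩ := exists_avoid hbot (minimalPrimes S)
      (minimalPrimes.finite_of_isNoetherianRing S) (fun P hP => hP.1.1) hmin
    have := isLocalRing_quot hx
    have h1 := spanFinrank_quot hx hx2
    have h2 : ringKrullDim S ≤ ringKrullDim (S ⧸ Ideal.span {x}) + 1 := by
      have := ringKrullDim_le_ringKrullDim_quotSMulTop_succ hx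
      rwa [← Submodule.ideal_span_singleton_smul, smul_eq_mul, Ideal.mul_top] at this
    have h3 := ringKrullDim_le_spanFinrank_maximalIdeal (S ⧸ Ideal.span {x})
    have h4 : ringKrullDim (S ⧸ Ideal.span {x}) = d := by
      refine le_antisymm (h3.trans (by exact_mod_cast (by lia))) ?_
      rw [hd] at h2
      generalize ringKrullDim (S ⧸ Ideal.span {x}) = a at h2
      exact withBot_cancel h2
    obtain ⟨hdom, hq⟩ := ih (S ⧸ Ideal.span {x}) h4 (by lia)
    have hprime : (Ideal.span {x}).IsPrime := (Ideal.Quotient.isDomain_iff_prime _).mp hdom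
    obtain ⟨P, hP, hPx⟩ := Ideal.exists_minimalPrimes_le (bot_le (a := Ideal.span {x}))
    have hPp : P.IsPrime := hP.1.1
    have hPbot : P = ⊥ := by
      refine Submodule.eq_bot_of_le_smul_of_le_jacobson_bot (maximalIdeal S) _
        (IsNoetherian.noetherian _) ?_ ?_
      · intro p hp
        obtain ⟨a, rfl⟩ := Ideal.mem_span_singleton'.mp (hPx hp)
        have ha : a ∈ P := (hPp.mem_or_mem hp).resolve_right (hxP P hP)
        rw [mul_comm]
        exact Submodule.smul_mem_smul hx ha
      · rw [IsLocalRing.jacobson_eq_maximalIdeal _ bot_ne_top]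
    subst hPbot
    have hdS : IsDomain S := IsDomain.of_bot_isPrime S
    refine ⟨hdS, HasRegGen.cons hx ?_ hq⟩
    have hx0 : x ≠ 0 := by simpa using hxP ⊥ hP
    intro a b hab
    exact mul_left_cancel₀ hx0 hab


lemma exists_retract {R : Type u} [CommRing R] [IsLocalRing R] {x : R}
    (hx : x ∈ maximalIdeal R) (hx2 : x ∉ maximalIdeal R ^ 2)
    [IsLocalRing (R ⧸ Ideal.span {x})] :
    ∃ (i : ResidueField (R ⧸ Ideal.span {x}) →ₗ[R ⧸ Ideal.span {x}]
        QuotSMulTop x (maximalIdeal R))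
      (p : QuotSMulTop x (maximalIdeal R) →ₗ[R ⧸ Ideal.span {x}]
        ResidueField (R ⧸ Ideal.span {x})), p ∘ₗ i = LinearMap.id := by
  have hxb0 : (maximalIdeal R).toCotangent ⟨x, hx⟩ ≠ 0 := by
    rw [Ne, Ideal.toCotangent_eq_zero]
    exact hx2
  obtain ⟨φ, hφ⟩ : ∃ φ : CotangentSpace R →ₗ[ResidueField R] ResidueField R,
      φ ((maximalIdeal R).toCotangent ⟨x, hx⟩) = 1 := by
    obtain ⟨φ, hφ⟩ := Module.Projective.exists_dual_ne_zero (ResidueField R) hxb0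
    refine ⟨(φ ((maximalIdeal R).toCotangent ⟨x, hx⟩))⁻¹ • φ, ?_⟩
    simp [hφ]
  have hloc : IsLocalHom (algebraMap R (R ⧸ Ideal.span {x})) :=
    IsLocalHom.of_surjective (Ideal.Quotient.mk (Ideal.span {x})) Ideal.Quotient.mk_surjective
  have hkill : ∀ a ∈ maximalIdeal R,
      algebraMap R (ResidueField (R ⧸ Ideal.span {x})) a = 0 := by
    intro a ha
    rw [IsScalarTower.algebraMap_apply R (R ⧸ Ideal.span {x})]
    rw [ResidueField.algebraMap_eq, residue_eq_zero_iff, ← map_maximalIdeal_quot]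
    exact Ideal.mem_map_of_mem _ ha
  let e : ResidueField R →ₗ[R] ResidueField (R ⧸ Ideal.span {x}) :=
    Submodule.liftQ (maximalIdeal R) (Algebra.linearMap R _) (fun a ha => hkill a ha)
  have he : e 1 = 1 := map_one (algebraMap R (ResidueField (R ⧸ Ideal.span {x})))
  let p0 : maximalIdeal R →ₗ[R] ResidueField (R ⧸ Ideal.span {x}) :=
    e ∘ₗ (φ.restrictScalars R) ∘ₗ (maximalIdeal R).toCotangent
  have hp0 : p0 ⟨x, hx⟩ = 1 := by
    simp only [p0, LinearMap.comp_apply, LinearMap.restrictScalars_apply]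
    rw [hφ, he]
  let p1 : QuotSMulTop x (maximalIdeal R) →ₗ[R] ResidueField (R ⧸ Ideal.span {x}) :=
    Submodule.liftQ _ p0 (by
      intro y hy
      obtain ⟨z, -, rfl⟩ := hy
      change p0 (x • z) = 0
      rw [map_smul, Algebra.smul_def, hkill x hx, zero_mul])
  have hp1 : p1 (Submodule.Quotient.mk ⟨x, hx⟩) = 1 := hp0
  let p := p1.extendScalarsOfSurjective (S := R ⧸ Ideal.span {x}) Ideal.Quotient.mk_surjective
  have hp : p (Submodule.Quotient.mk ⟨x, hx⟩) = 1 := hp1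
  let i : ResidueField (R ⧸ Ideal.span {x}) →ₗ[R ⧸ Ideal.span {x}]
      QuotSMulTop x (maximalIdeal R) :=
    Submodule.liftQ (maximalIdeal (R ⧸ Ideal.span {x}))
      (LinearMap.toSpanSingleton _ _ (Submodule.Quotient.mk ⟨x, hx⟩)) (by
        intro a ha
        obtain ⟨b, rfl⟩ := Ideal.Quotient.mk_surjective a
        have hb : b ∈ maximalIdeal R := by
          by_contra hb
          rw [mem_maximalIdeal, mem_nonunits_iff, not_not] at hb
          exact ha (hb.map _)
        change b • (Submodule.Quotient.mk ⟨x, hx⟩ : QuotSMulTop x (maximalIdeal R)) = 0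
        rw [← Submodule.Quotient.mk_smul, Submodule.Quotient.mk_eq_zero]
        refine ⟨⟨b, hb⟩, trivial, ?_⟩
        ext
        exact mul_comm x b)
  refine ⟨i, p, ?_⟩
  ext c
  obtain ⟨a, rfl⟩ := residue_surjective c
  change p (a • Submodule.Quotient.mk ⟨x, hx⟩) = _
  rw [map_smul, hp, Algebra.smul_def, mul_one]
  rfl

lemma exists_step {R : Type u} [CommRing R] [IsLocalRing R] [IsNoetherianRing R] (N : ℕ)
    (h : PdLE R (ResidueField R) N) (hm : maximalIdeal R ≠ ⊥) :
    ∃ x ∈ maximalIdeal R, IsSMulRegular R x ∧ ∀ [IsLocalRing (R ⧸ Ideal.span {x})],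
      PdLE (R ⧸ Ideal.span {x}) (ResidueField (R ⧸ Ideal.span {x})) N := by
  have hass : ∀ P ∈ associatedPrimes R R, ¬ maximalIdeal R ≤ P := by
    intro P hP hle
    obtain ⟨hPp, s, hs⟩ := isAssociatedPrime_iff.mp hP
    have hPm : P = maximalIdeal R := le_antisymm (le_maximalIdeal hPp.ne_top) hle
    have hsm : ∀ a ∈ maximalIdeal R, s * a = 0 := by
      intro a ha
      rw [← hPm, hs, Submodule.mem_colon_singleton] at ha
      rw [mul_comm]
      simpa using ha
    have hs0 : s ≠ 0 := by
      rintro rfl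
      refine hPp.ne_top ?_
      rw [hs]
      ext
      simp [Submodule.mem_colon_singleton]
    have hfree := free_of_pdLE_of_socle s hs0 hsm N (ResidueField R) h
    refine hm (eq_bot_iff.mpr fun a ha => ?_)
    have : FaithfulSMul R (ResidueField R) := inferInstance
    refine FaithfulSMul.eq_of_smul_eq_smul (M := R) (α := ResidueField R) fun c => ?_
    rw [zero_smul, Algebra.smul_def, ResidueField.algebraMap_eq, (residue_eq_zero_iff a).mpr ha,
      zero_mul]
  obtain ⟨x, hx, hx2, hxP⟩ := exists_avoid hm (associatedPrimes R R)
    (associatedPrimes.finite R R) (fun P hP => hP.1) hass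
  have hreg : IsSMulRegular R x := by
    have hx0 : x ∈ nonZeroDivisors R := by
      by_contra hcon
      have : x ∈ ((nonZeroDivisors R : Set R))ᶜ := hcon
      rw [← biUnion_associatedPrimes_eq_compl_nonZeroDivisors] at this
      obtain ⟨P, hP, hxP'⟩ := Set.mem_iUnion₂.mp this
      exact hxP P hP hxP'
    intro a b hab
    exact (mul_cancel_left_mem_nonZeroDivisors hx0).mp hab
  refine ⟨x, hx, hreg, ?_⟩
  intro _
  obtain ⟨i, p, hip⟩ := exists_retract hx hx2
  have h1 : PdLE R (maximalIdeal R) N := by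
    have h2 := (pdLE_succ_iff (M := ResidueField R) (F := R)
      (f := (maximalIdeal R).mkQ) (Submodule.mkQ_surjective _) N).mp (h.mono (Nat.le_succ N))
    exact h2.equiv (LinearEquiv.ofEq _ _ (Submodule.ker_mkQ _).symm)
  have h2 : IsSMulRegular (maximalIdeal R) x := by
    intro a b hab
    exact Subtype.ext (hreg (congrArg Subtype.val hab))
  exact (PdLE.quotSMulTop x hreg N _ h2 h1).retract i p hip

lemma hasRegGen_of_pdLE (n N : ℕ) : ∀ (R : Type u) [CommRing R] [IsLocalRing R]
    [IsNoetherianRing R], ringKrullDim R = n → PdLE R (ResidueField R) N → HasRegGen R := by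
  induction n with
  | zero =>
    intro R _ _ _ hd h
    by_cases hm : maximalIdeal R = ⊥
    · exact ⟨[], by simp, by rw [hm, Ideal.ofList_nil]⟩
    obtain ⟨x, hx, hreg, -⟩ := exists_step N h hm
    have := isLocalRing_quot hx
    have h1 := ringKrullDim_quotient_span_singleton_succ_eq_ringKrullDim hreg hx
    rw [hd] at h1
    have h2 := ringKrullDim_nonneg_of_nontrivial (R := R ⧸ Ideal.span {x})
    have h3 : (0 : WithBot ℕ∞) + 1 ≤ ringKrullDim (R ⧸ Ideal.span {x}) + 1 := by gcongr
    rw [h1] at h3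
    norm_num at h3
  | succ n ih =>
    intro R _ _ _ hd h
    by_cases hm : maximalIdeal R = ⊥
    · exact ⟨[], by simp, by rw [hm, Ideal.ofList_nil]⟩
    obtain ⟨x, hx, hreg, hpd⟩ := exists_step N h hm
    have := isLocalRing_quot hx
    have h1 := ringKrullDim_quotient_span_singleton_succ_eq_ringKrullDim hreg hx
    rw [hd] at h1
    refine HasRegGen.cons hx hreg (ih _ ?_ hpd)
    refine le_antisymm ?_ (withBot_cancel h1.ge)
    generalize ringKrullDim (R ⧸ Ideal.span {x}) = a at h1
    induction a with
    | bot => exact bot_le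
    | coe a =>
      induction a with
      | top =>
        have h2 : (⊤ : ℕ∞) + 1 = ((n + 1 : ℕ) : ℕ∞) := by exact_mod_cast h1
        rw [top_add] at h2
        exact absurd h2.symm (ENat.natCast_ne_top _)
      | coe a =>
        have h1 : a + 1 = n + 1 := by exact_mod_cast h1
        have h2 : a ≤ n := by lia
        exact_mod_cast h2

lemma exists_finset_of_hasRegGen {R : Type u} [CommRing R] [IsLocalRing R] [IsNoetherianRing R]
    (h : HasRegGen R) : ∃ s : Finset R, Ideal.span (↑s : Set R) = maximalIdeal R ∧
      (s.card : WithBot (WithTop ℕ)) = ringKrullDim R := by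
  obtain ⟨rs, h1, h2⟩ := h
  have hmem : ∀ r ∈ rs, r ∈ maximalIdeal R := fun r hr => by
    rw [← h2]
    exact Ideal.subset_span hr
  have h3 := ringKrullDim_add_length_eq_ringKrullDim_of_isRegular rs
    (IsRegular.of_isWeaklyRegular_of_mem_maximalIdeal R hmem h1)
  rw [h2] at h3
  have h4 : ringKrullDim (R ⧸ maximalIdeal R) = 0 :=
    ringKrullDim_eq_zero_of_field (ResidueField R)
  rw [h4, zero_add] at h3
  obtain ⟨s, hs, hs'⟩ := Submodule.FG.exists_span_finset_card_eq_spanFinrank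
    (IsNoetherian.noetherian (maximalIdeal R))
  refine ⟨s, hs', le_antisymm ?_ ?_⟩
  · rw [← h3, hs]
    have h5 : (maximalIdeal R).spanFinrank ≤ rs.length := by
      classical
      rw [← h2]
      have h6 : Ideal.ofList rs = Submodule.span R (rs.toFinset : Set R) := by
        simp [Ideal.ofList, Ideal.span]
      rw [h6]
      refine (Submodule.spanFinrank_span_le_ncard_of_finite (Finset.finite_toSet _)).trans ?_
      rw [Set.ncard_coe_finset]
      exact List.toFinset_card_le rs
    have h6 : ((maximalIdeal R).spanFinrank : WithBot ℕ∞) ≤ (rs.length : WithBot ℕ∞) := by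
      exact_mod_cast h5
    exact h6
  · rw [hs]
    exact ringKrullDim_le_spanFinrank_maximalIdeal R

theorem main {R : Type u} {S : Type v} [CommRing R] [CommRing S]
    [IsLocalRing R] [IsLocalRing S] [IsNoetherianRing R] [IsNoetherianRing S]
    [Algebra R S] [Module.FaithfullyFlat R S] (s : Finset S)
    (hs : Ideal.span (↑s : Set S) = maximalIdeal S)
    (hc : (s.card : WithBot (WithTop ℕ)) = ringKrullDim S) :
    ∃ s : Finset R, Ideal.span (↑s : Set R) = maximalIdeal R ∧
      (s.card : WithBot (WithTop ℕ)) = ringKrullDim R := by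
  have h1 : (maximalIdeal S).spanFinrank ≤ s.card := by
    rw [← hs]
    refine (Submodule.spanFinrank_span_le_ncard_of_finite (Finset.finite_toSet _)).trans ?_
    rw [Set.ncard_coe_finset]
  obtain ⟨-, rs, hrs, hm⟩ := regular_aux s.card S hc.symm h1
  have h2 := pdLE_descent (R := R) rs hrs hm rs.length 0 (by lia) (ResidueField R) (by simp)
  obtain ⟨n, hn⟩ : ∃ n : ℕ, ringKrullDim R = n := by
    have h3 := ringKrullDim_le_spanFinrank_maximalIdeal R
    have h4 := ringKrullDim_nonneg_of_nontrivial (R := R)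
    generalize ringKrullDim R = a at h3 h4
    induction a with
    | bot => simp at h4
    | coe a =>
      induction a with
      | top => exact absurd h3 (not_le.mpr (by exact_mod_cast ENat.natCast_lt_top _))
      | coe a => exact ⟨a, rfl⟩
  exact exists_finset_of_hasRegGen (hasRegGen_of_pdLE n _ R hn h2)

end RegDescent

theorem regular_descends_along_faithfully_flat
    (R S : Type*) [CommRing R] [CommRing S]
    [IsLocalRing R] [IsLocalRing S]
    [IsNoetherianRing R] [IsNoetherianRing S]
    [Algebra R S] [Module.FaithfullyFlat R S]
    (hS : IsRegularLocal S) :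
    IsRegularLocal R := by
  obtain ⟨-, s, hs, hc⟩ := hS
  exact ⟨inferInstance, RegDescent.main s hs hc⟩
end

section
/- Let R be a Noetherian supercommutative superalgebra over a field of characteristic ≠ 2 satisfying: (i) R̄ = R/I_R is smooth as a k-algebra, (ii) I_R/I_R² is a finitely generated projective R̄-module, and suppose given a section s : R̄ → R₀ of the projection R₀ → R̄ and a section t : I_R/I_R² → I_R of the projection in R̄-supermodules. Then the unique R̄-superalgebra map Λ_{R̄}(I_R/I_R²) → R extending t is an isomorphism of superalgebras, provided R is smooth (every superalgebra surjection onto R with nilpotent kernel splits). -/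
/-!
STATEMENT 19: Let `R` be a Noetherian smooth supercommutative superalgebra over a field
`k` of characteristic ≠ 2 with (i) `R̄ = R/I_R` smooth as a `k`-algebra and (ii) the
conormal module `M = I_R/I_R²` finitely generated projective over `R̄`.  Given a section
`s : R̄ → R₀` of `R₀ → R̄` and a section `t : M → I_R` of the projection (in
`R̄`-supermodules, so `t` has odd values), the unique `R̄`-superalgebra map
`Λ_{R̄}(M) → R` extending `t` is an isomorphism.
-/

variable {k : Type} [Field k]

/-- The square of `I_R`, as a `k`-submodule. -/
def oddIdealSq {R : Type} [Ring R] [Algebra k R] (𝒜 : ZMod 2 → Submodule k R) :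
    Submodule k R :=
  Submodule.span k {x | ∃ y ∈ oddIdeal 𝒜, ∃ z ∈ oddIdeal 𝒜, x = y * z}

namespace SuperExt

theorem eq_top_of_sup_sq {A : Type} [Ring A] [Algebra k A] (S : Subalgebra k A)
    (J : Submodule k A) (hJJ : J * J ≤ J) (N : ℕ) (hN : J ^ N = ⊥)
    (h : ∀ x : A, ∃ s ∈ S, x - s ∈ J * J) : ∀ x : A, x ∈ S := by
  have key : ∀ n : ℕ, ∀ x ∈ J ^ (n+1), ∃ s ∈ S, s ∈ J ^ (n+1) ∧ x - s ∈ J ^ (n+2) := by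
    intro n
    induction n with
    | zero =>
      intro x hx
      obtain ⟨s, hs, hxs⟩ := h x
      simp only [zero_add, pow_one] at hx ⊢
      refine ⟨s, hs, ?_, by rwa [pow_two]⟩
      have := J.sub_mem hx (hJJ hxs)
      simpa using this
    | succ n ih =>
      intro x hx
      rw [pow_succ] at hx
      induction hx using Submodule.mul_induction_on' with
      | mem_mul_mem a ha b hb =>
        obtain ⟨s, hs, hsJ, has⟩ := ih a ha
        obtain ⟨u, hu, hbu⟩ := h b
        have huJ : u ∈ J := by simpa using J.sub_mem hb (hJJ hbu)
        refine ⟨s * u, S.mul_mem hs hu, ?_, ?_⟩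
        · rw [pow_succ]; exact Submodule.mul_mem_mul hsJ huJ
        · have e : a * b - s * u = (a - s) * b + s * (b - u) := by noncomm_ring
          rw [e]
          refine Submodule.add_mem _ ?_ ?_
          · rw [pow_succ]; exact Submodule.mul_mem_mul has hb
          · have := Submodule.mul_mem_mul hsJ hbu
            rwa [← pow_two, ← pow_add] at this
      | add a _ b _ ha hb =>
        obtain ⟨s, hs, h1, h2⟩ := ha
        obtain ⟨u, hu, h3, h4⟩ := hb
        refine ⟨s + u, S.add_mem hs hu, Submodule.add_mem _ h1 h3, ?_⟩
        rw [add_sub_add_comm]; exact Submodule.add_mem _ h2 h4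
  have key2 : ∀ n : ℕ, ∀ x : A, ∃ s ∈ S, x - s ∈ J ^ (n+1) := by
    intro n
    induction n with
    | zero =>
      intro x
      obtain ⟨s, hs, hx⟩ := h x
      exact ⟨s, hs, by simpa using hJJ hx⟩
    | succ n ih =>
      intro x
      obtain ⟨s, hs, hx⟩ := ih x
      obtain ⟨u, hu, _, hx'⟩ := key n _ hx
      exact ⟨s + u, S.add_mem hs hu, by rwa [← sub_sub]⟩
  intro x
  obtain ⟨s, hs, hx⟩ := key2 N x
  rw [pow_succ, hN, Submodule.bot_mul, Submodule.mem_bot, sub_eq_zero] at hx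
  rwa [hx]

section
variable {A : Type} [Ring A] [Algebra k A] (𝒜 : ZMod 2 → Submodule k A) [GradedAlgebra 𝒜]

theorem mul_top_le (hsc : ∀ (i j : ZMod 2) (a b : A), a ∈ 𝒜 i → b ∈ 𝒜 j →
      b * a = ((-1 : ℤ) ^ (i.val * j.val)) • (a * b))
    (W : Submodule k A) (hW : W ≤ 𝒜 1) : W * ⊤ ≤ ⊤ * W := by
  rw [Submodule.mul_le]
  intro w hw b _
  induction b using DirectSum.Decomposition.inductionOn 𝒜 with
  | zero => simp
  | homogeneous b =>
    rw [hsc _ 1 _ w b.2 (hW hw)]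
    exact zsmul_mem (Submodule.mul_mem_mul Submodule.mem_top hw) _
  | add a b ha hb => rw [mul_add]; exact Submodule.add_mem _ (ha trivial) (hb trivial)

theorem top_mul_mul_top_le (hsc : ∀ (i j : ZMod 2) (a b : A), a ∈ 𝒜 i → b ∈ 𝒜 j →
      b * a = ((-1 : ℤ) ^ (i.val * j.val)) • (a * b))
    (W : Submodule k A) (hW : W ≤ 𝒜 1) : (⊤ * W) * ⊤ ≤ ⊤ * W := by
  rw [mul_assoc]
  refine (mul_le_mul_right (mul_top_le 𝒜 hsc W hW) _).trans ?_
  rw [← mul_assoc]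
  exact mul_le_mul_left le_top _

theorem top_mul_top_mul_le (W : Submodule k A) : ⊤ * (⊤ * W) ≤ ⊤ * W := by
  rw [← mul_assoc]
  exact mul_le_mul_left le_top _

theorem odd_sq (h2 : (2 : k) ≠ 0) (hsc : ∀ (i j : ZMod 2) (a b : A), a ∈ 𝒜 i → b ∈ 𝒜 j →
      b * a = ((-1 : ℤ) ^ (i.val * j.val)) • (a * b)) (r : A) (hr : r ∈ 𝒜 1) : r * r = 0 := by
  have h := hsc 1 1 r r hr hr
  have e : (1 : ZMod 2).val = 1 := rfl
  rw [e] at h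
  simp only [mul_one, pow_one, neg_smul, one_smul] at h
  have h3 : (2 : k) • (r * r) = 0 := by
    rw [two_smul]; nth_rewrite 1 [h]; simp
  exact (smul_eq_zero.mp h3).resolve_left h2

theorem nilp (h2 : (2 : k) ≠ 0)
    (hsc : ∀ (i j : ZMod 2) (a b : A), a ∈ 𝒜 i → b ∈ 𝒜 j →
      b * a = ((-1 : ℤ) ^ (i.val * j.val)) • (a * b)) (F : Set A) (hF : F.Finite)
    (hF1 : F ⊆ 𝒜 1) : ∃ N, ((⊤ : Submodule k A) * Submodule.span k F) ^ N = ⊥ := by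
  induction F, hF using Set.Finite.induction_on with
  | empty => exact ⟨1, by simp⟩
  | @insert r F _ _ ih =>
    obtain ⟨N, hN⟩ := ih ((Set.subset_insert _ _).trans hF1)
    have hr : r ∈ 𝒜 1 := hF1 (Set.mem_insert _ _)
    have hFs : Submodule.span k F ≤ 𝒜 1 :=
      Submodule.span_le.2 ((Set.subset_insert _ _).trans hF1)
    have hrs : Submodule.span k {r} ≤ 𝒜 1 :=
      Submodule.span_le.2 (by simpa using hr)
    have hsq : ((⊤ : Submodule k A) * Submodule.span k {r}) *
        ((⊤ : Submodule k A) * Submodule.span k {r}) = ⊥ := by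
      rw [← mul_assoc, eq_bot_iff]
      refine (mul_le_mul_left (top_mul_mul_top_le 𝒜 hsc _ hrs) _).trans ?_
      rw [mul_assoc, Submodule.span_mul_span]
      simp [odd_sq 𝒜 h2 hsc r hr]
    refine ⟨2 * N, ?_⟩
    rw [pow_mul, eq_bot_iff, ← hN]
    refine pow_le_pow_left' ?_ N
    rw [Set.insert_eq, Submodule.span_union, Submodule.mul_sup, pow_two, Submodule.sup_mul,
      Submodule.mul_sup, Submodule.mul_sup, hsq]
    refine sup_le (sup_le bot_le ?_) (sup_le ?_ ?_)
    · exact (mul_le_mul_left le_top _).trans (top_mul_top_mul_le _)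
    · exact (mul_le_mul_right le_top _).trans (top_mul_mul_top_le 𝒜 hsc _ hFs)
    · exact (mul_le_mul_left le_top _).trans (top_mul_top_mul_le _)

theorem superIdeal (hsc : ∀ (i j : ZMod 2) (a b : A), a ∈ 𝒜 i → b ∈ 𝒜 j →
      b * a = ((-1 : ℤ) ^ (i.val * j.val)) • (a * b))
    (W : Submodule k A) (hW : W ≤ 𝒜 1) : IsSuperIdeal 𝒜 (⊤ * W) := by
  refine ⟨fun r x hx => top_mul_top_mul_le W (Submodule.mul_mem_mul trivial hx),
    fun r x hx => top_mul_mul_top_le 𝒜 hsc W hW (Submodule.mul_mem_mul hx trivial), ?_⟩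
  intro x hx i
  induction hx using Submodule.mul_induction_on' with
  | mem_mul_mem a _ w hw =>
    have e : i = (i - 1) + 1 := by ring
    rw [e, DirectSum.coe_decompose_mul_add_of_right_mem 𝒜 (hW hw)]
    exact Submodule.mul_mem_mul trivial hw
  | add a _ b _ ha hb =>
    rw [DirectSum.decompose_add, DirectSum.add_apply, Submodule.coe_add]
    exact Submodule.add_mem _ ha hb

theorem oddIdeal_le (hsc : ∀ (i j : ZMod 2) (a b : A), a ∈ 𝒜 i → b ∈ 𝒜 j →
      b * a = ((-1 : ℤ) ^ (i.val * j.val)) • (a * b)) : oddIdeal 𝒜 = ⊤ * 𝒜 1 := by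
  apply le_antisymm
  · refine Submodule.span_le.2 ?_
    rintro _ ⟨r, hr, a, b, rfl⟩
    exact top_mul_mul_top_le 𝒜 hsc _ le_rfl
      (Submodule.mul_mem_mul (Submodule.mul_mem_mul trivial hr) trivial)
  · rw [Submodule.mul_le]
    intro a _ r hr
    exact Submodule.subset_span ⟨r, hr, a, 1, by simp⟩

theorem oddIdealSq_eq : oddIdealSq 𝒜 = oddIdeal 𝒜 * oddIdeal 𝒜 := by
  apply le_antisymm
  · refine Submodule.span_le.2 ?_
    rintro _ ⟨y, hy, z, hz, rfl⟩
    exact Submodule.mul_mem_mul hy hz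
  · rw [Submodule.mul_le]
    intro y hy z hz
    exact Submodule.subset_span ⟨y, hy, z, hz, rfl⟩

theorem oddIdeal_nilp (h2 : (2 : k) ≠ 0)
    (hsc : ∀ (i j : ZMod 2) (a b : A), a ∈ 𝒜 i → b ∈ 𝒜 j →
      b * a = ((-1 : ℤ) ^ (i.val * j.val)) • (a * b))
    (hacc : ∀ c : ℕ → Submodule k A, (∀ n, IsSuperIdeal 𝒜 (c n)) → Monotone c →
      ∃ n, ∀ m, n ≤ m → c m = c n) : ∃ N, oddIdeal 𝒜 ^ N = ⊥ := by
  have wf : WellFoundedGT {J : Submodule k A // IsSuperIdeal 𝒜 J} := by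
    rw [wellFoundedGT_iff_monotone_chain_condition]
    intro a
    obtain ⟨n, hn⟩ := hacc (fun n => (a n).1) (fun n => (a n).2) (fun i j h => a.monotone h)
    exact ⟨n, fun m hm => Subtype.ext (hn m hm).symm⟩
  obtain ⟨J, ⟨F, hF, hF1, hJ⟩, hmax⟩ := wf.wf.has_min
    {J | ∃ F : Set A, F.Finite ∧ F ⊆ 𝒜 1 ∧ J.1 = ⊤ * Submodule.span k F}
    ⟨⟨⊤ * Submodule.span k ∅, superIdeal 𝒜 hsc _ (by simp)⟩, ∅, Set.finite_empty, by simp, rfl⟩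
  have hle : 𝒜 1 ≤ ⊤ * Submodule.span k F := by
    intro r hr
    have hs : insert r F ⊆ (𝒜 1 : Set A) := Set.insert_subset hr hF1
    have h1 := hmax ⟨⊤ * Submodule.span k (insert r F),
      superIdeal 𝒜 hsc _ (Submodule.span_le.2 hs)⟩ ⟨_, hF.insert r, hs, rfl⟩
    by_contra hcon
    apply h1
    show J < _
    rw [← Subtype.coe_lt_coe, hJ]
    refine lt_of_le_not_ge (mul_le_mul_right (Submodule.span_mono (Set.subset_insert _ _)) _) ?_
    intro h
    apply hcon
    apply h
    have := Submodule.mul_mem_mul (M := (⊤ : Submodule k A)) (m := 1) trivial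
      (Submodule.subset_span (R := k) (Set.mem_insert r F))
    simpa using this
  obtain ⟨N, hN⟩ := nilp 𝒜 h2 hsc F hF hF1
  refine ⟨N, ?_⟩
  rw [eq_bot_iff, ← hN, oddIdeal_le 𝒜 hsc]
  exact pow_le_pow_left' ((mul_le_mul_right hle _).trans (top_mul_top_mul_le _)) N

end

end SuperExt

namespace SuperExt

section
variable (B : Type) [CommRing B] [Algebra k B]
  (M : Type) [AddCommGroup M] [Module B M] [Module k M] [IsScalarTower k B M]

/-- The parity grading of the exterior algebra, over the small base field. -/
def extGr (k : Type) [Field k] (B : Type) [CommRing B] [Algebra k B]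
    (M : Type) [AddCommGroup M] [Module B M] [Module k M] [IsScalarTower k B M] :
    ZMod 2 → Submodule k (ExteriorAlgebra B M) :=
  fun i => (CliffordAlgebra.evenOdd (0 : QuadraticForm B M) i).restrictScalars k

noncomputable instance extGraded : GradedAlgebra (extGr k B M) where
  one_mem := (CliffordAlgebra.evenOdd.gradedMonoid (0 : QuadraticForm B M)).one_mem
  mul_mem := (CliffordAlgebra.evenOdd.gradedMonoid (0 : QuadraticForm B M)).mul_mem
  decompose' := (CliffordAlgebra.gradedAlgebra (0 : QuadraticForm B M)).decompose'
  left_inv := (CliffordAlgebra.gradedAlgebra (0 : QuadraticForm B M)).left_inv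
  right_inv := (CliffordAlgebra.gradedAlgebra (0 : QuadraticForm B M)).right_inv

theorem ext_sc (i j : ZMod 2) (a b : ExteriorAlgebra B M) (ha : a ∈ extGr k B M i)
    (hb : b ∈ extGr k B M j) : b * a = ((-1 : ℤ) ^ (i.val * j.val)) • (a * b) := by
  have h := CliffordAlgebra.map_mul_map_of_isOrtho_of_mem_evenOdd
    (QuadraticMap.Isometry.id (0 : QuadraticForm B M))
    (QuadraticMap.Isometry.id (0 : QuadraticForm B M))
    (fun x y => by simp [QuadraticMap.IsOrtho]) b a hb ha
  simp only [CliffordAlgebra.map_id, AlgHom.id_apply] at h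
  rw [h]
  have h01 : ∀ i : ZMod 2, i = 0 ∨ i = 1 := by decide
  have v1 : (1 : ZMod 2).val = 1 := rfl
  rcases h01 i with rfl | rfl <;> rcases h01 j with rfl | rfl <;> simp [v1]

theorem ext_decomp (J : Submodule k (ExteriorAlgebra B M))
    (hι : ∀ m, ExteriorAlgebra.ι B m ∈ J) (hl : ⊤ * J ≤ J) (hr : J * ⊤ ≤ J)
    (x : ExteriorAlgebra B M) : ∃ (b : B) (m : M), ∃ j ∈ J * J,
      x = algebraMap B _ b + ExteriorAlgebra.ι B m + j := by
  have hl' : ∀ x, ∀ j ∈ J * J, x * j ∈ J * J := by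
    intro x j hj
    have := Submodule.mul_mem_mul (Submodule.mem_top (R := k) (x := x)) hj
    rw [← mul_assoc] at this
    exact mul_le_mul_left hl _ this
  have hr' : ∀ x, ∀ j ∈ J * J, j * x ∈ J * J := by
    intro x j hj
    have := Submodule.mul_mem_mul hj (Submodule.mem_top (R := k) (x := x))
    rw [mul_assoc] at this
    exact mul_le_mul_right hr _ this
  induction x using ExteriorAlgebra.induction with
  | algebraMap b => exact ⟨b, 0, 0, Submodule.zero_mem _, by simp⟩
  | ι m => exact ⟨0, m, 0, Submodule.zero_mem _, by simp⟩
  | add x y hx hy =>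
    obtain ⟨b, m, j, hj, rfl⟩ := hx
    obtain ⟨b', m', j', hj', rfl⟩ := hy
    refine ⟨b + b', m + m', j + j', Submodule.add_mem _ hj hj', ?_⟩
    simp only [map_add]; abel
  | mul x y hx hy =>
    obtain ⟨b, m, j, hj, rfl⟩ := hx
    obtain ⟨b', m', j', hj', rfl⟩ := hy
    refine ⟨b * b', b • m' + b' • m, ExteriorAlgebra.ι B m * ExteriorAlgebra.ι B m' +
      ((algebraMap B _ b + ExteriorAlgebra.ι B m) * j' +
        j * (algebraMap B _ b' + ExteriorAlgebra.ι B m' + j')), ?_, ?_⟩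
    · exact Submodule.add_mem _ (Submodule.mul_mem_mul (hι m) (hι m'))
        (Submodule.add_mem _ (hl' _ _ hj') (hr' _ _ hj))
    · simp only [map_add, map_smul, map_mul, Algebra.smul_def]
      rw [Algebra.commutes b' (ExteriorAlgebra.ι B m)]
      noncomm_ring

theorem list_prod_mem_pow {A : Type} [Ring A] [Algebra k A] (J : Submodule k A) (l : List A)
    (h : ∀ x ∈ l, x ∈ J) : l.prod ∈ J ^ l.length := by
  induction l with
  | nil => exact ⟨1, by simp⟩
  | cons a l ih =>
    rw [List.prod_cons, List.length_cons, pow_succ']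
    exact Submodule.mul_mem_mul (h a (by simp)) (ih fun x hx => h x (by simp [hx]))

end

end SuperExt

theorem smooth_noetherian_superalgebra_is_exterior_algebra
    (h2 : (2 : k) ≠ 0)
    (R : Type) [Ring R] [Algebra k R]
    (𝒜 : ZMod 2 → Submodule k R) [GradedAlgebra 𝒜]
    (hsc : ∀ (i j : ZMod 2) (a b : R), a ∈ 𝒜 i → b ∈ 𝒜 j →
      b * a = ((-1 : ℤ) ^ (i.val * j.val)) • (a * b))
    -- `R` is Noetherian: super-ideals satisfy the ACC
    (hacc : ∀ c : ℕ → Submodule k R, (∀ n, IsSuperIdeal 𝒜 (c n)) → Monotone c →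
      ∃ n, ∀ m, n ≤ m → c m = c n)
    -- `R` is smooth as a superalgebra: every superalgebra surjection onto `R`
    -- with nilpotent kernel splits
    (hsmooth : ∀ (T : Type) [Ring T] [Algebra k T]
      (𝒯 : ZMod 2 → Submodule k T), ∀ [GradedAlgebra 𝒯],
      (∀ (i j : ZMod 2) (a b : T), a ∈ 𝒯 i → b ∈ 𝒯 j →
        b * a = ((-1 : ℤ) ^ (i.val * j.val)) • (a * b)) →
      ∀ (f : T →ₐ[k] R), Function.Surjective f →
        (∀ (i : ZMod 2), ∀ a ∈ 𝒯 i, f a ∈ 𝒜 i) →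
        (∃ n : ℕ, ∀ l : List T, (∀ x ∈ l, f x = 0) → n ≤ l.length → l.prod = 0) →
        ∃ g : R →ₐ[k] T, (∀ (i : ZMod 2), ∀ a ∈ 𝒜 i, g a ∈ 𝒯 i) ∧
          f.comp g = AlgHom.id k R)
    -- `R̄`, realized as an abstract commutative `k`-algebra with a surjection
    -- `p : R → R̄` whose kernel is `I_R`
    (Rbar : Type) [CommRing Rbar] [Algebra k Rbar]
    (p : R →ₐ[k] Rbar) (hp : Function.Surjective p)
    (hker : ∀ x : R, p x = 0 ↔ x ∈ oddIdeal 𝒜)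
    -- (i) `R̄` is smooth as a `k`-algebra
    (hRbarSmooth : Algebra.FormallySmooth k Rbar)
    -- the section `s : R̄ → R₀ ⊆ R` of `R₀ → R̄`, making `R` an `R̄`-algebra
    [Algebra Rbar R] [IsScalarTower k Rbar R]
    (hsec : ∀ x : Rbar, p (algebraMap Rbar R x) = x)
    (hsec0 : ∀ x : Rbar, algebraMap Rbar R x ∈ 𝒜 0)
    -- the conormal module `M = I_R/I_R²`, realized as an abstract `R̄`-module with a
    -- surjection `q : I_R → M` whose kernel is `I_R²`
    (M : Type) [AddCommGroup M] [Module Rbar M] [Module k M] [IsScalarTower k Rbar M]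
    (q : ↥(oddIdeal 𝒜) →ₗ[k] M)
    (hq : Function.Surjective q)
    (hqker : ∀ x : ↥(oddIdeal 𝒜), q x = 0 ↔ (x : R) ∈ oddIdealSq 𝒜)
    (hqlin : ∀ (b : Rbar) (x : ↥(oddIdeal 𝒜)) (hbx : algebraMap Rbar R b * x ∈ oddIdeal 𝒜),
      q ⟨algebraMap Rbar R b * x, hbx⟩ = b • q x)
    -- (ii) `M` is finitely generated projective over `R̄`
    (hMproj : Module.Projective Rbar M) (hMfin : Module.Finite Rbar M)
    -- the section `t : M → I_R` of `q` in `R̄`-supermodules (odd values)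
    (t : M →ₗ[Rbar] R)
    (ht1 : ∀ m : M, t m ∈ 𝒜 1) (htI : ∀ m : M, t m ∈ oddIdeal 𝒜)
    (hqt : ∀ m : M, q ⟨t m, htI m⟩ = m) :
    -- conclusion: the (unique) `R̄`-algebra map `Λ_{R̄}(M) → R` extending `t`
    -- is an isomorphism of superalgebras
    ∀ φ : ExteriorAlgebra Rbar M →ₐ[Rbar] R,
      (∀ m : M, φ (ExteriorAlgebra.ι Rbar m) = t m) → Function.Bijective φ := by
  intro φ hφ
  have hI := SuperExt.oddIdeal_le 𝒜 hsc
  have hIsq := SuperExt.oddIdealSq_eq 𝒜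
  obtain ⟨N, hN⟩ := SuperExt.oddIdeal_nilp 𝒜 h2 hsc hacc
  have hIl : ⊤ * oddIdeal 𝒜 ≤ oddIdeal 𝒜 := by
    rw [hI]; exact SuperExt.top_mul_top_mul_le _
  let φk : ExteriorAlgebra Rbar M →ₐ[k] R := φ.restrictScalars k
  have hφk : ∀ x, φk x = φ x := fun _ => rfl
  -- surjectivity
  have hsurj : Function.Surjective φk := by
    have := SuperExt.eq_top_of_sup_sq φk.range (oddIdeal 𝒜)
      ((mul_le_mul_left le_top _).trans hIl) N hN (by
        intro x
        have hy : x - algebraMap Rbar R (p x) ∈ oddIdeal 𝒜 := by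
          rw [← hker, map_sub, hsec, sub_self]
        refine ⟨algebraMap Rbar R (p x) + t (q ⟨_, hy⟩), ?_, ?_⟩
        · refine ⟨algebraMap Rbar _ (p x) + ExteriorAlgebra.ι Rbar (q ⟨_, hy⟩), ?_⟩
          change φ _ = _
          rw [map_add, hφ, AlgHom.commutes]
        · rw [← hIsq, ← sub_sub]
          have := (hqker (⟨_, hy⟩ - ⟨t (q ⟨_, hy⟩), htI _⟩)).1 (by rw [map_sub, hqt, sub_self])
          exact this)
    intro x
    exact this x
  -- parity
  have hpar : ∀ i : ZMod 2, ∀ a ∈ SuperExt.extGr k Rbar M i, φk a ∈ 𝒜 i := by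
    have h11 : (1 : ZMod 2) + 1 = 0 := rfl
    have hmm : ∀ (m₁ m₂ : M) (i : ZMod 2) (x : R), x ∈ 𝒜 i → t m₁ * t m₂ * x ∈ 𝒜 i := by
      intro m₁ m₂ i x hx
      have := SetLike.mul_mem_graded (SetLike.mul_mem_graded (ht1 m₁) (ht1 m₂)) hx
      rwa [h11, zero_add] at this
    intro i a ha
    fin_cases i
    · refine CliffordAlgebra.even_induction (0 : QuadraticForm Rbar M)
        (motive := fun x _ => φ x ∈ 𝒜 0) ?_ ?_ ?_ a ha
      · intro r; rw [AlgHom.commutes]; exact hsec0 r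
      · intro x y _ _ hx hy; rw [map_add]; exact Submodule.add_mem _ hx hy
      · intro m₁ m₂ x _ hx
        rw [map_mul, map_mul]
        erw [hφ, hφ]
        exact hmm _ _ _ _ hx
    · refine CliffordAlgebra.odd_induction (0 : QuadraticForm Rbar M)
        (P := fun x _ => φ x ∈ 𝒜 1) ?_ ?_ ?_ a ha
      · intro r; erw [hφ]; exact ht1 r
      · intro x y _ _ hx hy; rw [map_add]; exact Submodule.add_mem _ hx hy
      · intro m₁ m₂ x _ hx
        rw [map_mul, map_mul]
        erw [hφ, hφ]
        exact hmm _ _ _ _ hx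
  -- the augmentation ideal of the exterior algebra
  obtain ⟨S, hS⟩ := hMfin.fg_top
  let F : Set (ExteriorAlgebra Rbar M) := ExteriorAlgebra.ι Rbar '' (S : Set M)
  have hF1 : F ⊆ SuperExt.extGr k Rbar M 1 := by
    rintro _ ⟨m, _, rfl⟩
    exact CliffordAlgebra.ι_mem_evenOdd_one _ m
  let J : Submodule k (ExteriorAlgebra Rbar M) := ⊤ * Submodule.span k F
  have hFs : Submodule.span k F ≤ SuperExt.extGr k Rbar M 1 := Submodule.span_le.2 hF1
  obtain ⟨L, hL⟩ := SuperExt.nilp (SuperExt.extGr k Rbar M) h2 (SuperExt.ext_sc Rbar M) F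
    (S.finite_toSet.image _) hF1
  change J ^ L = ⊥ at hL
  have hJl : ⊤ * J ≤ J := SuperExt.top_mul_top_mul_le _
  have hJr : J * ⊤ ≤ J :=
    SuperExt.top_mul_mul_top_le (SuperExt.extGr k Rbar M) (SuperExt.ext_sc Rbar M) _ hFs
  have hJJ : J * J ≤ J := (mul_le_mul_left le_top _).trans hJl
  have hι : ∀ m, ExteriorAlgebra.ι Rbar m ∈ J := by
    intro m
    have hm : m ∈ Submodule.span Rbar (S : Set M) := by rw [hS]; trivial
    induction hm using Submodule.span_induction with
    | mem x hx =>
      have := Submodule.mul_mem_mul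
        (Submodule.mem_top (R := k) (x := (1 : ExteriorAlgebra Rbar M)))
        (Submodule.subset_span (R := k) (s := F) ⟨x, hx, rfl⟩)
      rwa [one_mul] at this
    | zero => rw [map_zero]; exact J.zero_mem
    | add x y _ _ hx hy => rw [map_add]; exact J.add_mem hx hy
    | smul a x _ hx =>
      rw [map_smul, Algebra.smul_def]
      exact hJl (Submodule.mul_mem_mul Submodule.mem_top hx)
  have hφJ : J.map φk.toLinearMap ≤ oddIdeal 𝒜 := by
    rw [Submodule.map_mul, hI]
    refine mul_le_mul' le_top ?_
    rw [Submodule.map_le_iff_le_comap]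
    exact fun x hx => hpar 1 x (hFs hx)
  have hφJJ : ∀ j ∈ J * J, φ j ∈ oddIdealSq 𝒜 := by
    intro j hj
    rw [hIsq]
    have := Submodule.mem_map_of_mem (f := φk.toLinearMap) hj
    rw [Submodule.map_mul] at this
    exact mul_le_mul' hφJ hφJ this
  have hIsqI : oddIdealSq 𝒜 ≤ oddIdeal 𝒜 := by
    rw [hIsq]; exact (mul_le_mul_left le_top _).trans hIl
  have hK : ∀ x, φk x = 0 → x ∈ J * J := by
    intro x hx
    obtain ⟨b, m, j, hj, rfl⟩ := SuperExt.ext_decomp Rbar M J hι hJl hJr x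
    rw [hφk, map_add, map_add, hφ, AlgHom.commutes] at hx
    have hpt := (hker _).2 (htI m)
    have hpj := (hker _).2 (hIsqI (hφJJ j hj))
    have hb : b = 0 := by
      have := congrArg p hx
      simpa [hsec, hpt, hpj] using this
    subst hb
    rw [map_zero, zero_add] at hx
    have htm : t m ∈ oddIdealSq 𝒜 := by
      rw [eq_neg_of_add_eq_zero_left hx]
      exact Submodule.neg_mem _ (hφJJ j hj)
    have hm : m = 0 := by
      rw [← hqt m]
      exact (hqker ⟨t m, htI m⟩).2 htm
    subst hm
    simpa using hj
  obtain ⟨g, _, hfg⟩ := hsmooth (ExteriorAlgebra Rbar M) (SuperExt.extGr k Rbar M)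
    (SuperExt.ext_sc Rbar M) φk hsurj hpar ⟨L, by
      intro l hl hlen
      have := SuperExt.list_prod_mem_pow J l (fun x hx => hJJ (hK x (hl x hx)))
      rw [← Nat.sub_add_cancel hlen, pow_add, hL, Submodule.mul_bot] at this
      simpa using this⟩
  have hfg' : ∀ x, φk (g x) = x := fun x => DFunLike.congr_fun hfg x
  have hg := SuperExt.eq_top_of_sup_sq g.range J hJJ L hL (by
    intro x
    exact ⟨g (φk x), ⟨_, rfl⟩, hK _ (by rw [map_sub, hfg', sub_self])⟩)
  refine ⟨?_, hsurj⟩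
  intro x y hxy
  obtain ⟨a, rfl⟩ := hg x
  obtain ⟨b, rfl⟩ := hg y
  have : a = b := by rw [← hfg' a, ← hfg' b]; exact hxy
  rw [this]
end
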